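/- Let κ satisfy the energy, consistency, and domination principles, and suppose the topology of X has a countable base. Then for every μ ∈ E⁺ and every Borel set B ⊂ X, the outer balayage μ^{*B} exists: there is a measure ν₀ ∈ Λ*_{B,μ} with κν₀ ≤ κν everywhere on X for all ν ∈ Λ*_{B,μ}; moreover μ^{*B} = μ^B, the inner balayage of μ to B. -/

import Mathlib

open MeasureTheory Filter Topology Set
open scoped ENNReal NNReal

namespace Balayage

variable {X : Type*} [TopologicalSpace X] [T2Space X] [LocallyCompactSpace X]
  [MeasurableSpace X] [BorelSpace X]

/-- The potential `κμ(x) := ∫ κ(x,y) dμ(y)`. -/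
noncomputable def pot (κ : X → X → ℝ≥0∞) (μ : Measure X) (x : X) : ℝ≥0∞ :=
  ∫⁻ y, κ x y ∂μ

/-- The mutual energy `κ(μ,ν) := ∬ κ(x,y) d(μ⊗ν)(x,y)`. -/
noncomputable def energy (κ : X → X → ℝ≥0∞) (μ ν : Measure X) : ℝ≥0∞ :=
  ∫⁻ x, pot κ ν x ∂μ

/-- A positive Radon measure: locally finite and inner regular. -/
def IsRadon (μ : Measure X) : Prop :=
  μ.InnerRegular ∧ IsLocallyFiniteMeasure μ

/-- `E⁺`: the positive Radon measures of finite energy. -/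
def Eplus (κ : X → X → ℝ≥0∞) : Set (Measure X) :=
  {μ | IsRadon μ ∧ energy κ μ μ < ⊤}

/-- `μ` is concentrated on `A`: `A` is `μ`-measurable and `X∖A` is locally `μ`-negligible. -/
def ConcOn (μ : Measure X) (A : Set X) : Prop :=
  NullMeasurableSet A μ ∧ ∀ K : Set X, IsCompact K → μ (Aᶜ ∩ K) = 0

/-- `E⁺_A`: measures of finite energy concentrated on `A`. -/
def EplusOn (κ : X → X → ℝ≥0∞) (A : Set X) : Set (Measure X) :=
  {μ ∈ Eplus κ | ConcOn μ A}

/-- The inner capacity `c_*(A)`. -/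
noncomputable def innerCap (κ : X → X → ℝ≥0∞) (A : Set X) : ℝ≥0∞ :=
  (⨅ μ ∈ {μ ∈ EplusOn κ A | μ Set.univ = 1}, energy κ μ μ)⁻¹

/-- `P` holds nearly everywhere on `A`: the set where it fails has inner capacity zero. -/
def NEOn (κ : X → X → ℝ≥0∞) (A : Set X) (P : X → Prop) : Prop :=
  innerCap κ {x | x ∈ A ∧ ¬ P x} = 0

/-- The outer capacity `c^*(A)`. -/
noncomputable def outerCap (κ : X → X → ℝ≥0∞) (A : Set X) : ℝ≥0∞ :=
  ⨅ D ∈ {D : Set X | IsOpen D ∧ A ⊆ D}, innerCap κ D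

/-- `P` holds quasi-everywhere on `A`: the set where it fails has outer capacity zero. -/
def QEOn (κ : X → X → ℝ≥0∞) (A : Set X) (P : X → Prop) : Prop :=
  outerCap κ {x | x ∈ A ∧ ¬ P x} = 0

/-- The class `Λ_{A,μ}` of measures `ν ∈ E⁺` with `κν ≥ κμ` n.e. on `A`. -/
def InnerLam (κ : X → X → ℝ≥0∞) (A : Set X) (μ : Measure X) : Set (Measure X) :=
  {ν ∈ Eplus κ | NEOn κ A (fun x => pot κ μ x ≤ pot κ ν x)}

/-- The class `Λ*_{A,μ}` of measures `ν ∈ E⁺` with `κν ≥ κμ` q.e. on `A`. -/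
def OuterLam (κ : X → X → ℝ≥0∞) (A : Set X) (μ : Measure X) : Set (Measure X) :=
  {ν ∈ Eplus κ | QEOn κ A (fun x => pot κ μ x ≤ pot κ ν x)}

/-- `b` is the inner balayage `μ^A`: the measure of minimal potential in `Λ_{A,μ}`. -/
def IsInnerBal (κ : X → X → ℝ≥0∞) (A : Set X) (μ b : Measure X) : Prop :=
  b ∈ InnerLam κ A μ ∧ ∀ ν ∈ InnerLam κ A μ, ∀ x, pot κ b x ≤ pot κ ν x

/-- `b` is the outer balayage `μ^{*A}`: the measure of minimal potential in `Λ*_{A,μ}`. -/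
def IsOuterBal (κ : X → X → ℝ≥0∞) (A : Set X) (μ b : Measure X) : Prop :=
  b ∈ OuterLam κ A μ ∧ ∀ ν ∈ OuterLam κ A μ, ∀ x, pot κ b x ≤ pot κ ν x

/-- The strong (energy) distance `‖μ − ν‖`. -/
noncomputable def strDist (κ : X → X → ℝ≥0∞) (μ ν : Measure X) : ℝ :=
  Real.sqrt ((energy κ μ μ).toReal - 2 * (energy κ μ ν).toReal + (energy κ ν ν).toReal)

/-- The energy principle (strict positive definiteness). -/
def EnergyPrinciple (κ : X → X → ℝ≥0∞) : Prop :=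
  ∀ μ ∈ Eplus κ, ∀ ν ∈ Eplus κ,
    2 * energy κ μ ν ≤ energy κ μ μ + energy κ ν ν ∧
      (2 * energy κ μ ν = energy κ μ μ + energy κ ν ν → μ = ν)

/-- Vague convergence of a net of measures along a filter. -/
def VagueConv {ι : Type*} (F : Filter ι) (m : ι → Measure X) (ν : Measure X) : Prop :=
  ∀ f : X → ℝ, Continuous f → HasCompactSupport f →
    Tendsto (fun i => ∫ x, f x ∂(m i)) F (nhds (∫ x, f x ∂ν))

/-- A net of measures is strong Cauchy (for the energy metric) along a filter. -/
def StrongCauchy (κ : X → X → ℝ≥0∞) {ι : Type*} (F : Filter ι) (m : ι → Measure X) : Prop :=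
  ∀ ε : ℝ, 0 < ε → ∃ s ∈ F, ∀ i ∈ s, ∀ j ∈ s, strDist κ (m i) (m j) < ε

/-- The consistency principle: every strong Cauchy net in `E⁺` converges strongly
to each of its vague limit points. -/
def Consistent (κ : X → X → ℝ≥0∞) : Prop :=
  ∀ (ι : Type) (F : Filter ι) (m : ι → Measure X), F.NeBot →
    (∀ i, m i ∈ Eplus κ) → StrongCauchy κ F m →
    ∀ ν : Measure X, (∃ G : Filter ι, G ≤ F ∧ G.NeBot ∧ VagueConv G m ν) →
      Tendsto (fun i => strDist κ (m i) ν) F (nhds 0)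

/-- The domination principle. -/
def Domination (κ : X → X → ℝ≥0∞) : Prop :=
  ∀ μ ∈ Eplus κ, ∀ ν ∈ Eplus κ,
    (∀ᵐ x ∂μ, pot κ μ x ≤ pot κ ν x) → ∀ x, pot κ μ x ≤ pot κ ν x

/-- A kernel: symmetric and lower semicontinuous. -/
structure IsKernel (κ : X → X → ℝ≥0∞) : Prop where
  symm : ∀ x y, κ x y = κ y x
  lsc : LowerSemicontinuous (Function.uncurry κ)

/-- `E'_A`: the strong closure of `E⁺_A` within `E⁺`. -/
def EclosOn (κ : X → X → ℝ≥0∞) (A : Set X) : Set (Measure X) :=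
  {ν ∈ Eplus κ | ∀ ε : ℝ, 0 < ε → ∃ μ ∈ EplusOn κ A, strDist κ ν μ < ε}

/-- The (real-valued) potential of the signed measure `λ = lp − lm`. -/
noncomputable def spot (κ : X → X → ℝ≥0∞) (lp lm : Measure X) (x : X) : ℝ :=
  (pot κ lp x).toReal - (pot κ lm x).toReal

/-- Assumption (A2): every `f ∈ C_c(X)` is the limit, uniformly with supports in one fixed
compact set, of a sequence of potentials of signed measures of finite energy that are
continuous and compactly supported. -/
def A2 (κ : X → X → ℝ≥0∞) : Prop :=
  ∀ f : X → ℝ, Continuous f → HasCompactSupport f →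
    ∃ (K : Set X) (lp lm : ℕ → Measure X), IsCompact K ∧ tsupport f ⊆ K ∧
      (∀ j, lp j ∈ Eplus κ ∧ lm j ∈ Eplus κ) ∧
      (∀ j x, pot κ (lp j) x ≠ ⊤ ∨ pot κ (lm j) x ≠ ⊤) ∧
      (∀ j, Continuous (spot κ (lp j) (lm j))) ∧
      (∀ j, tsupport (spot κ (lp j) (lm j)) ⊆ K) ∧
      TendstoUniformly (fun j => spot κ (lp j) (lm j)) f atTop

set_option linter.unusedSectionVars false

/-- In a second-countable locally compact space, a nonnegative lower semicontinuous function is the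
increasing limit of a sequence of nonnegative compactly supported continuous functions. -/
theorem exists_seq_compactlySupported_iSup_eq [SecondCountableTopology X] {g : X → ℝ≥0∞}
    (hg : LowerSemicontinuous g) :
    ∃ ψ : ℕ → X → ℝ, (∀ n, Continuous (ψ n) ∧ HasCompactSupport (ψ n) ∧ 0 ≤ ψ n) ∧
      Monotone ψ ∧ ∀ x, ⨆ n, ENNReal.ofReal (ψ n x) = g x := by
  let S : Set (X → ℝ) := {φ | (Continuous φ ∧ HasCompactSupport φ ∧ 0 ≤ φ) ∧
    ∀ x, ENNReal.ofReal (φ x) ≤ g x}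
  have hcount (q : ℚ) : ∃ T ⊆ S, T.Countable ∧
      ⋃ φ ∈ T, {x | (q : ℝ) < φ x} = ⋃ φ ∈ S, {x | (q : ℝ) < φ x} :=
    TopologicalSpace.isOpen_biUnion_countable S _
      fun φ hφ => isOpen_lt continuous_const hφ.1.1
  choose T hTS hTc hTU using hcount
  have h0 : (0 : X → ℝ) ∈ S := ⟨⟨continuous_const, HasCompactSupport.zero, le_rfl⟩, by simp⟩
  let T' : Set (X → ℝ) := insert 0 (⋃ q, T q)
  have hT'c : T'.Countable := (countable_iUnion hTc).insert 0
  have hT'S : T' ⊆ S := insert_subset h0 (iUnion_subset hTS)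
  obtain ⟨φ, hφ⟩ := hT'c.exists_eq_range ⟨0, mem_insert _ _⟩
  have hφS (n : ℕ) : φ n ∈ S := hT'S (hφ ▸ mem_range_self n)
  have hps (n : ℕ) : partialSups φ n ∈ S := by
    induction n with
    | zero => simpa using hφS 0
    | succ n ih =>
      rw [partialSups_add_one]
      obtain ⟨⟨h1, h2, h3⟩, h4⟩ := ih
      obtain ⟨⟨k1, k2, k3⟩, k4⟩ := hφS (n + 1)
      refine ⟨⟨h1.sup k1, ?_, le_sup_of_le_left h3⟩, fun x => ?_⟩
      · refine HasCompactSupport.intro (h2.isCompact.union k2.isCompact) fun x hx => ?_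
        simp only [mem_union, not_or] at hx
        simp [image_eq_zero_of_notMem_tsupport hx.1, image_eq_zero_of_notMem_tsupport hx.2]
      · simp only [Pi.sup_apply, ENNReal.ofReal_max]
        exact max_le (h4 x) (k4 x)
  refine ⟨fun n => partialSups φ n, fun n => (hps n).1, (partialSups φ).monotone, fun x => ?_⟩
  refine le_antisymm (iSup_le fun n => (hps n).2 x) (le_of_forall_lt fun c hc => ?_)
  obtain ⟨q, hq0, hcq, hqg⟩ := ENNReal.lt_iff_exists_rat_btwn.1 hc
  obtain ⟨a, hqa, hag⟩ := ENNReal.lt_iff_exists_nnreal_btwn.1 hqg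
  have hV : IsOpen {y | (a : ℝ≥0∞) < g y} := hg.isOpen_preimage a
  obtain ⟨u, hu1, hu0, huc, hu⟩ := exists_continuous_one_zero_of_isCompact
    (isCompact_singleton (x := x)) hV.isClosed_compl
    (by simpa [disjoint_singleton_left] using hag)
  have hmem : (fun y => (a : ℝ) * u y) ∈ S := by
    refine ⟨⟨continuous_const.mul u.continuous, huc.mul_left, fun y =>
      mul_nonneg a.2 (hu y).1⟩, fun y => ?_⟩
    by_cases hy : (a : ℝ≥0∞) < g y
    · refine le_trans ?_ hy.le
      rw [← ENNReal.ofReal_coe_nnreal]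
      exact ENNReal.ofReal_le_ofReal (mul_le_of_le_one_right a.2 (hu y).2)
    · have : u y = 0 := hu0 hy
      simp [this]
  have hqa' : (q : ℝ) < a := by
    have : Real.toNNReal q < a := by exact_mod_cast hqa
    exact (Real.toNNReal_lt_iff_lt_coe (by exact_mod_cast hq0)).1 this
  have hx : x ∈ ⋃ φ ∈ S, {x | (q : ℝ) < φ x} := by
    refine mem_biUnion hmem ?_
    have : u x = 1 := hu1 rfl
    simpa [this] using hqa'
  rw [← hTU q] at hx
  obtain ⟨ψ, hψ, hqψ⟩ := mem_iUnion₂.1 hx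
  obtain ⟨n, rfl⟩ : ψ ∈ range φ := hφ ▸ Or.inr (mem_iUnion.2 ⟨q, hψ⟩)
  refine hcq.trans_le (le_trans ?_ (le_iSup _ n))
  exact ENNReal.ofReal_le_ofReal (le_trans (le_of_lt hqψ) (le_partialSups φ n x))

/-- Integrals of lower semicontinuous functions are lower semicontinuous under vague
convergence. -/
theorem VagueConv.lintegral_le [SecondCountableTopology X] {ι : Type*} {U : Filter ι} [U.NeBot]
    {m : ι → Measure X} {ν : Measure X} (h : VagueConv U m ν)
    (hm : ∀ i, IsLocallyFiniteMeasure (m i)) (hν : IsLocallyFiniteMeasure ν) {g : X → ℝ≥0∞}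
    (hg : LowerSemicontinuous g) {C : ℝ≥0∞} (hC : ∀ᶠ i in U, ∫⁻ x, g x ∂(m i) ≤ C) :
    ∫⁻ x, g x ∂ν ≤ C := by
  obtain ⟨ψ, hψ, hmono, hsup⟩ := exists_seq_compactlySupported_iSup_eq hg
  have key (μ : Measure X) [IsLocallyFiniteMeasure μ] (n : ℕ) :
      ENNReal.ofReal (∫ x, ψ n x ∂μ) = ∫⁻ x, ENNReal.ofReal (ψ n x) ∂μ :=
    ofReal_integral_eq_lintegral_ofReal
      ((hψ n).1.integrable_of_hasCompactSupport (hψ n).2.1) (ae_of_all _ (hψ n).2.2)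
  simp_rw [← hsup]
  rw [lintegral_iSup (fun n => (hψ n).1.measurable.ennreal_ofReal)
    (fun i j hij x => ENNReal.ofReal_le_ofReal (hmono hij x))]
  refine iSup_le fun n => ?_
  rw [← key]
  refine le_of_tendsto ((ENNReal.continuous_ofReal.tendsto _).comp
    (h (ψ n) (hψ n).1 (hψ n).2.1)) (hC.mono fun i hi => ?_)
  simp only [Function.comp_apply]
  rw [key]
  exact (lintegral_mono fun x => (le_iSup (fun n => ENNReal.ofReal (ψ n x)) n).trans_eq
    (hsup x)).trans hi

/-- A sequence of measures uniformly bounded on compact sets has a vague limit along any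
ultrafilter. -/
theorem exists_vagueConv (U : Ultrafilter ℕ) {m : ℕ → Measure X}
    (hm : ∀ n, IsLocallyFiniteMeasure (m n))
    (hb : ∀ K, IsCompact K → ∃ M : ℝ≥0, ∀ n, m n K ≤ M) :
    ∃ ν : Measure X, IsLocallyFiniteMeasure ν ∧ VagueConv (U : Filter ℕ) m ν := by
  have hlim (f : CompactlySupportedContinuousMap X ℝ) :
      ∃ l, Tendsto (fun n => ∫ x, f x ∂(m n)) U (𝓝 l) := by
    obtain ⟨M, hM⟩ := hb _ f.hasCompactSupport
    obtain ⟨C, hC⟩ := f.hasCompactSupport.exists_bound_of_continuous f.continuous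
    have hmem (n : ℕ) : ∫ x, f x ∂(m n) ∈ Metric.closedBall (0 : ℝ) (|C| * M) := by
      rw [mem_closedBall_zero_iff, ← setIntegral_tsupport]
      refine (norm_setIntegral_le_of_norm_le_const
        (lt_of_le_of_lt (hM n) ENNReal.coe_lt_top)
        fun x _ => (hC x).trans (le_abs_self C)).trans ?_
      exact mul_le_mul_of_nonneg_left (ENNReal.toReal_le_coe_of_le_coe (hM n)) (abs_nonneg C)
    obtain ⟨l, -, hl⟩ := (isCompact_closedBall (0 : ℝ) (|C| * M)).ultrafilter_le_nhds
      (U.map fun n => ∫ x, f x ∂(m n)) (by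
        rw [le_principal_iff]
        exact Filter.mem_map.2 (univ_mem' hmem))
    exact ⟨l, hl⟩
  choose Λ hΛ using hlim
  let L : CompactlySupportedContinuousMap X ℝ →ₚ[ℝ] ℝ := PositiveLinearMap.mk₀
    { toFun := Λ
      map_add' := fun f g => by
        refine tendsto_nhds_unique (hΛ (f + g)) (((hΛ f).add (hΛ g)).congr fun n => ?_)
        exact (integral_add' f.integrable g.integrable).symm
      map_smul' := fun c f => by
        refine tendsto_nhds_unique (hΛ (c • f)) (((hΛ f).const_mul c).congr fun n => ?_)
        exact (integral_smul c f).symm }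
    fun f hf => ge_of_tendsto (hΛ f) (Eventually.of_forall fun n => integral_nonneg hf)
  refine ⟨RealRMK.rieszMeasure L, inferInstance, fun f hf hfc => ?_⟩
  have := RealRMK.integral_rieszMeasure L ⟨⟨f, hf⟩, hfc⟩
  have h2 := hΛ ⟨⟨f, hf⟩, hfc⟩
  simp only [CompactlySupportedContinuousMap.coe_mk, ContinuousMap.coe_mk] at this h2
  rw [this]
  exact h2
section Energy

variable [SecondCountableTopology X] {κ : X → X → ℝ≥0∞}

theorem mem_Eplus_iff {μ : Measure X} :
    μ ∈ Eplus κ ↔ IsLocallyFiniteMeasure μ ∧ energy κ μ μ < ⊤ :=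
  ⟨fun h => ⟨h.1.2, h.2⟩, fun ⟨_, h⟩ => ⟨⟨inferInstance, ‹_›⟩, h⟩⟩

theorem isLocallyFiniteMeasure_of_mem_Eplus {μ : Measure X} (h : μ ∈ Eplus κ) :
    IsLocallyFiniteMeasure μ := h.1.2

theorem IsKernel.measurable (hker : IsKernel κ) : Measurable (Function.uncurry κ) :=
  hker.lsc.measurable

theorem IsKernel.lowerSemicontinuous_right (hker : IsKernel κ) (x : X) :
    LowerSemicontinuous (κ x) :=
  LowerSemicontinuous.comp (f := Function.uncurry κ) hker.lsc (Continuous.prodMk_right x)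

theorem IsKernel.lowerSemicontinuous_pot (hker : IsKernel κ) (μ : Measure X) :
    LowerSemicontinuous (pot κ μ) := by
  rw [lowerSemicontinuous_iff_le_liminf]
  intro x
  refine le_trans (lintegral_mono fun y => ?_)
    (lintegral_liminf_le fun z => (hker.lowerSemicontinuous_right z).measurable)
  exact lowerSemicontinuous_iff_le_liminf.1
    (LowerSemicontinuous.comp hker.lsc (Continuous.prodMk_left y)) x

theorem IsKernel.measurable_pot (hker : IsKernel κ) (μ : Measure X) : Measurable (pot κ μ) :=
  (hker.lowerSemicontinuous_pot μ).measurable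

theorem energy_comm (hker : IsKernel κ) (μ ν : Measure X) [SFinite μ] [SFinite ν] :
    energy κ μ ν = energy κ ν μ := by
  unfold energy pot
  rw [lintegral_lintegral_swap hker.measurable.aemeasurable]
  simp_rw [hker.symm]

theorem pot_add (μ ν : Measure X) (x : X) : pot κ (μ + ν) x = pot κ μ x + pot κ ν x :=
  lintegral_add_measure _ _ _

theorem pot_smul (c : ℝ≥0) (μ : Measure X) (x : X) : pot κ (c • μ) x = c * pot κ μ x :=
  lintegral_smul_measure _ _

theorem pot_mono {μ ν : Measure X} (h : μ ≤ ν) (x : X) : pot κ μ x ≤ pot κ ν x :=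
  lintegral_mono' h le_rfl

theorem energy_mono {μ μ' ν ν' : Measure X} (h : μ ≤ μ') (h' : ν ≤ ν') :
    energy κ μ ν ≤ energy κ μ' ν' :=
  lintegral_mono' h (pot_mono h')

theorem energy_add_left (μ ν τ : Measure X) :
    energy κ (μ + ν) τ = energy κ μ τ + energy κ ν τ :=
  lintegral_add_measure _ _ _

theorem energy_add_right (hker : IsKernel κ) (μ ν τ : Measure X) :
    energy κ τ (μ + ν) = energy κ τ μ + energy κ τ ν := by
  simp only [energy, pot_add]
  exact lintegral_add_left (hker.measurable_pot μ) _

theorem energy_smul_left (c : ℝ≥0) (μ τ : Measure X) :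
    energy κ (c • μ) τ = c * energy κ μ τ :=
  lintegral_smul_measure _ _

theorem energy_smul_right (hker : IsKernel κ) (c : ℝ≥0) (μ τ : Measure X) :
    energy κ τ (c • μ) = c * energy κ τ μ := by
  simp only [energy, pot_smul]
  exact lintegral_const_mul _ (hker.measurable_pot μ)

theorem energy_zero_right (μ : Measure X) : energy κ μ 0 = 0 := by simp [energy, pot]

theorem energy_lt_top (hE : EnergyPrinciple κ) {μ ν : Measure X} (hμ : μ ∈ Eplus κ)
    (hν : ν ∈ Eplus κ) : energy κ μ ν < ⊤ := by
  have h := (hE μ hμ ν hν).1.trans_lt (ENNReal.add_lt_top.2 ⟨hμ.2, hν.2⟩)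
  by_contra! h'
  simp [top_le_iff.1 h'] at h

theorem zero_mem_Eplus : (0 : Measure X) ∈ Eplus κ :=
  mem_Eplus_iff.2 ⟨inferInstance, by simp [energy]⟩

theorem Eplus_mono {μ ν : Measure X} (hν : ν ∈ Eplus κ) (h : μ ≤ ν) : μ ∈ Eplus κ := by
  have := isLocallyFiniteMeasure_of_mem_Eplus hν
  exact mem_Eplus_iff.2 ⟨Measure.isLocallyFiniteMeasure_of_le h, (energy_mono h h).trans_lt hν.2⟩

theorem Eplus_restrict {μ : Measure X} (hμ : μ ∈ Eplus κ) (s : Set X) : μ.restrict s ∈ Eplus κ :=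
  Eplus_mono hμ Measure.restrict_le_self

theorem Eplus_smul (hker : IsKernel κ) {μ : Measure X} (hμ : μ ∈ Eplus κ) (c : ℝ≥0) :
    c • μ ∈ Eplus κ := by
  have := isLocallyFiniteMeasure_of_mem_Eplus hμ
  refine mem_Eplus_iff.2 ⟨inferInstance, ?_⟩
  rw [energy_smul_left, energy_smul_right hker]
  exact ENNReal.mul_lt_top ENNReal.coe_lt_top (ENNReal.mul_lt_top ENNReal.coe_lt_top hμ.2)

theorem Eplus_add (hker : IsKernel κ) (hE : EnergyPrinciple κ) {μ ν : Measure X}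
    (hμ : μ ∈ Eplus κ) (hν : ν ∈ Eplus κ) : μ + ν ∈ Eplus κ := by
  have := isLocallyFiniteMeasure_of_mem_Eplus hμ
  have := isLocallyFiniteMeasure_of_mem_Eplus hν
  refine mem_Eplus_iff.2 ⟨⟨fun x => ?_⟩, ?_⟩
  · obtain ⟨s, hs, hsμ⟩ := μ.finiteAt_nhds x
    obtain ⟨t, ht, htν⟩ := ν.finiteAt_nhds x
    exact ⟨s ∩ t, inter_mem hs ht, ENNReal.add_lt_top.2
      ⟨(measure_mono inter_subset_left).trans_lt hsμ,
        (measure_mono inter_subset_right).trans_lt htν⟩⟩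
  · rw [energy_add_left, energy_add_right hker, energy_add_right hker]
    simp only [ENNReal.add_lt_top]
    exact ⟨⟨hμ.2, energy_lt_top hE hμ hν⟩, energy_lt_top hE hν hμ, hν.2⟩

/-- The mutual energy of two measures of finite energy as a real number. -/
noncomputable def inn (κ : X → X → ℝ≥0∞) (μ ν : Measure X) : ℝ := (energy κ μ ν).toReal

theorem inn_nonneg (μ ν : Measure X) : 0 ≤ inn κ μ ν := ENNReal.toReal_nonneg

theorem ofReal_inn (hE : EnergyPrinciple κ) {μ ν : Measure X} (hμ : μ ∈ Eplus κ)
    (hν : ν ∈ Eplus κ) : ENNReal.ofReal (inn κ μ ν) = energy κ μ ν :=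
  ENNReal.ofReal_toReal (energy_lt_top hE hμ hν).ne

theorem inn_comm (hker : IsKernel κ) {μ ν : Measure X} (hμ : μ ∈ Eplus κ)
    (hν : ν ∈ Eplus κ) : inn κ μ ν = inn κ ν μ := by
  have := isLocallyFiniteMeasure_of_mem_Eplus hμ
  have := isLocallyFiniteMeasure_of_mem_Eplus hν
  rw [inn, energy_comm hker, inn]

theorem inn_add_left (hE : EnergyPrinciple κ) {μ ν τ : Measure X} (hμ : μ ∈ Eplus κ)
    (hν : ν ∈ Eplus κ) (hτ : τ ∈ Eplus κ) : inn κ (μ + ν) τ = inn κ μ τ + inn κ ν τ := by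
  rw [inn, energy_add_left, ENNReal.toReal_add (energy_lt_top hE hμ hτ).ne
    (energy_lt_top hE hν hτ).ne, inn, inn]

theorem inn_add_right (hker : IsKernel κ) (hE : EnergyPrinciple κ) {μ ν τ : Measure X}
    (hμ : μ ∈ Eplus κ) (hν : ν ∈ Eplus κ) (hτ : τ ∈ Eplus κ) :
    inn κ τ (μ + ν) = inn κ τ μ + inn κ τ ν := by
  rw [inn, energy_add_right hker, ENNReal.toReal_add (energy_lt_top hE hτ hμ).ne
    (energy_lt_top hE hτ hν).ne, inn, inn]

theorem inn_smul_left (c : ℝ≥0) (μ τ : Measure X) : inn κ (c • μ) τ = c * inn κ μ τ := by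
  rw [inn, energy_smul_left, ENNReal.toReal_mul, inn, ENNReal.coe_toReal]

theorem inn_smul_right (hker : IsKernel κ) (c : ℝ≥0) (μ τ : Measure X) :
    inn κ τ (c • μ) = c * inn κ τ μ := by
  rw [inn, energy_smul_right hker, ENNReal.toReal_mul, inn, ENNReal.coe_toReal]

theorem two_mul_inn_le (hE : EnergyPrinciple κ) {μ ν : Measure X} (hμ : μ ∈ Eplus κ)
    (hν : ν ∈ Eplus κ) : 2 * inn κ μ ν ≤ inn κ μ μ + inn κ ν ν := by
  have h := ENNReal.toReal_mono (ENNReal.add_lt_top.2 ⟨hμ.2, hν.2⟩).ne (hE μ hμ ν hν).1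
  rwa [ENNReal.toReal_mul, ENNReal.toReal_add hμ.2.ne hν.2.ne, ENNReal.toReal_ofNat] at h

theorem strDist_nonneg (μ ν : Measure X) : 0 ≤ strDist κ μ ν := Real.sqrt_nonneg _

theorem strDist_sq (hE : EnergyPrinciple κ) {μ ν : Measure X} (hμ : μ ∈ Eplus κ)
    (hν : ν ∈ Eplus κ) : strDist κ μ ν ^ 2 = inn κ μ μ - 2 * inn κ μ ν + inn κ ν ν := by
  have := two_mul_inn_le hE hμ hν
  exact Real.sq_sqrt (by simp only [inn] at this; linarith)

/-- The Cauchy–Schwarz inequality for the difference of two measures of finite energy. -/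
theorem sq_inn_sub_inn_le (hker : IsKernel κ) (hE : EnergyPrinciple κ) {μ ν τ : Measure X}
    (hμ : μ ∈ Eplus κ) (hν : ν ∈ Eplus κ) (hτ : τ ∈ Eplus κ) :
    (inn κ μ τ - inn κ ν τ) ^ 2 ≤ strDist κ μ ν ^ 2 * inn κ τ τ := by
  have key {μ ν : Measure X} (hμ : μ ∈ Eplus κ) (hν : ν ∈ Eplus κ) (t : ℝ≥0) :
      0 ≤ strDist κ μ ν ^ 2 + 2 * t * (inn κ μ τ - inn κ ν τ) + t ^ 2 * inn κ τ τ := by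
    have hτt := Eplus_smul hker hτ t
    have h := sq_nonneg (strDist κ (μ + t • τ) ν)
    rw [strDist_sq hE (Eplus_add hker hE hμ hτt) hν] at h
    rw [strDist_sq hE hμ hν]
    simp only [inn_add_left hE hμ hτt, inn_add_right hker hE hμ hτt, hν, hμ, hτt,
      Eplus_add hker hE hμ hτt, inn_smul_left, inn_smul_right hker] at h
    rw [inn_comm hker hτ hμ, inn_comm hker hτ hν] at h
    linarith
  have hs : strDist κ ν μ ^ 2 = strDist κ μ ν ^ 2 := by
    rw [strDist_sq hE hμ hν, strDist_sq hE hν hμ, inn_comm hker hμ hν]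
    ring
  have hall (t : ℝ) : 0 ≤ inn κ τ τ * (t * t) + (2 * (inn κ μ τ - inn κ ν τ)) * t +
      strDist κ μ ν ^ 2 := by
    rcases le_total 0 t with ht | ht
    · have := key hμ hν (Real.toNNReal t)
      rw [Real.coe_toNNReal _ ht] at this
      linarith
    · have := key hν hμ (Real.toNNReal (-t))
      rw [Real.coe_toNNReal _ (by linarith), hs] at this
      linarith
  have := discrim_le_zero hall
  rw [discrim] at this
  linarith

theorem sq_inn_le (hker : IsKernel κ) (hE : EnergyPrinciple κ) {μ τ : Measure X}
    (hμ : μ ∈ Eplus κ) (hτ : τ ∈ Eplus κ) : inn κ μ τ ^ 2 ≤ inn κ μ μ * inn κ τ τ := by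
  have h := sq_inn_sub_inn_le hker hE hμ zero_mem_Eplus hτ
  rw [strDist_sq hE hμ zero_mem_Eplus] at h
  simpa [inn, energy_zero_right, show energy κ 0 τ = 0 by simp [energy]] using h

theorem tendsto_inn (hker : IsKernel κ) (hE : EnergyPrinciple κ) {m : ℕ → Measure X}
    {ν τ : Measure X} (hm : ∀ n, m n ∈ Eplus κ) (hν : ν ∈ Eplus κ) (hτ : τ ∈ Eplus κ)
    (h : Tendsto (fun n => strDist κ (m n) ν) atTop (𝓝 0)) :
    Tendsto (fun n => inn κ (m n) τ) atTop (𝓝 (inn κ ν τ)) := by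
  rw [tendsto_iff_dist_tendsto_zero]
  refine squeeze_zero (fun _ => dist_nonneg) (fun n => ?_)
    (by simpa using h.mul_const (Real.sqrt (inn κ τ τ)))
  rw [Real.dist_eq]
  refine abs_le_of_sq_le_sq ?_ (mul_nonneg (strDist_nonneg _ _) (Real.sqrt_nonneg _))
  rw [mul_pow, Real.sq_sqrt (inn_nonneg _ _)]
  exact sq_inn_sub_inn_le hker hE (hm n) hν hτ

theorem tendsto_inn_self (hker : IsKernel κ) (hE : EnergyPrinciple κ) {m : ℕ → Measure X}
    {ν : Measure X} (hm : ∀ n, m n ∈ Eplus κ) (hν : ν ∈ Eplus κ)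
    (h : Tendsto (fun n => strDist κ (m n) ν) atTop (𝓝 0)) :
    Tendsto (fun n => inn κ (m n) (m n)) atTop (𝓝 (inn κ ν ν)) := by
  have h1 := ((h.pow 2).add ((tendsto_inn hker hE hm hν hν h).const_mul 2)).sub_const (inn κ ν ν)
  have h2 : (0 : ℝ) ^ 2 + 2 * inn κ ν ν - inn κ ν ν = inn κ ν ν := by ring
  rw [h2] at h1
  refine h1.congr fun n => ?_
  rw [strDist_sq hE (hm n) hν]
  ring

end Energy
section Completeness

variable [SecondCountableTopology X] {κ : X → X → ℝ≥0∞}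

theorem VagueConv.energy_le (hker : IsKernel κ) {U : Filter ℕ} [U.NeBot] {m : ℕ → Measure X}
    {ν : Measure X} (hm : ∀ n, IsLocallyFiniteMeasure (m n)) (hν : IsLocallyFiniteMeasure ν)
    (h : VagueConv U m ν) {C : ℝ≥0∞} (hC : ∀ᶠ j in U, ∀ᶠ i in U, energy κ (m i) (m j) ≤ C) :
    energy κ ν ν ≤ C := by
  refine h.lintegral_le hm hν (hker.lowerSemicontinuous_pot ν) (hC.mono fun j hj => ?_)
  change energy κ (m j) ν ≤ C
  rw [energy_comm hker]
  exact h.lintegral_le hm hν (hker.lowerSemicontinuous_pot (m j)) hj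

/-- The energy principle bounds the mass on a compact set by the energy. -/
theorem exists_sq_measure_le (hker : IsKernel κ) (hE : EnergyPrinciple κ) {K : Set X}
    (hK : IsCompact K) : ∃ C : ℝ≥0, ∀ τ ∈ Eplus κ, τ K ^ 2 ≤ C * energy κ τ τ := by
  by_contra! h
  choose τ hτ hlt using fun n : ℕ => h (n + 1)
  have hfin (n : ℕ) : τ n K < ⊤ := by
    have := isLocallyFiniteMeasure_of_mem_Eplus (hτ n)
    exact hK.measure_lt_top
  have hpos (n : ℕ) : τ n K ≠ 0 := fun h0 => by simpa [h0] using hlt n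
  let a (n : ℕ) : ℝ≥0 := (τ n K).toNNReal
  have ha (n : ℕ) : (a n : ℝ≥0∞) = τ n K := ENNReal.coe_toNNReal (hfin n).ne
  have ha0 (n : ℕ) : a n ≠ 0 := fun h0 => hpos n (by rw [← ha, h0]; rfl)
  let ρ (n : ℕ) : Measure X := (a n)⁻¹ • (τ n).restrict K
  have hρ (n : ℕ) : ρ n ∈ Eplus κ := Eplus_smul hker (Eplus_restrict (hτ n) K) _
  have hρuniv (n : ℕ) : ρ n univ = 1 := by
    simp only [ρ, Measure.smul_apply, Measure.restrict_apply_univ, ← ha, ENNReal.smul_def,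
      smul_eq_mul]
    exact_mod_cast inv_mul_cancel₀ (ha0 n)
  have hρE (n : ℕ) : energy κ (ρ n) (ρ n) ≤ ((n : ℝ≥0∞) + 1)⁻¹ := by
    rw [ENNReal.le_inv_iff_mul_le, energy_smul_left, energy_smul_right hker]
    calc _ ≤ ((a n)⁻¹ : ℝ≥0) * (((a n)⁻¹ : ℝ≥0) * energy κ (τ n) (τ n)) * ((n : ℝ≥0∞) + 1) := by
            gcongr
            exact energy_mono Measure.restrict_le_self Measure.restrict_le_self
      _ = ((a n)⁻¹ : ℝ≥0) * ((a n)⁻¹ : ℝ≥0) * (((n + 1 : ℝ≥0) : ℝ≥0∞) * energy κ (τ n) (τ n)) := by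
            push_cast
            ring
      _ ≤ ((a n)⁻¹ : ℝ≥0) * ((a n)⁻¹ : ℝ≥0) * (τ n K) ^ 2 := by
            gcongr
            exact (hlt n).le
      _ = 1 := by
            rw [← ha]
            norm_cast
            field_simp [ha0 n]
  have hloc (n : ℕ) := isLocallyFiniteMeasure_of_mem_Eplus (hρ n)
  obtain ⟨ν, hν, hvc⟩ := exists_vagueConv (hyperfilter ℕ) hloc fun L _ =>
    ⟨1, fun n => (measure_mono (subset_univ L)).trans (hρuniv n).le⟩
  have hsmall (ε : ℝ≥0∞) (hε : ε ≠ 0) : ∀ᶠ n : ℕ in (hyperfilter ℕ : Filter ℕ),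
      energy κ (ρ n) (ρ n) ≤ ε := by
    refine Filter.Eventually.filter_mono Nat.hyperfilter_le_atTop ?_
    obtain ⟨N, hN⟩ := ENNReal.exists_inv_nat_lt hε
    filter_upwards [eventually_ge_atTop N] with n hn
    refine (hρE n).trans (le_trans (ENNReal.inv_le_inv.2 ?_) hN.le)
    exact le_trans (by exact_mod_cast hn) le_self_add
  have hE0 : energy κ ν ν = 0 := by
    by_contra hne
    obtain ⟨ε, hε0, hε⟩ := ENNReal.lt_iff_exists_nnreal_btwn.1 (pos_iff_ne_zero.2 hne)
    refine absurd (hvc.energy_le hker hloc hν (C := ε) ?_) (not_le.2 hε)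
    filter_upwards [hsmall ε hε0.ne'] with j hj
    filter_upwards [hsmall ε hε0.ne'] with i hi
    have h2 := (hE _ (hρ i) _ (hρ j)).1.trans (add_le_add hi hj)
    rw [← two_mul] at h2
    exact (ENNReal.mul_le_mul_iff_right two_ne_zero ENNReal.ofNat_ne_top).1 h2
  have hν0 : ν = 0 := by
    refine (hE ν (mem_Eplus_iff.2 ⟨hν, by simp [hE0]⟩) 0 zero_mem_Eplus).2 ?_
    simp [hE0, energy_zero_right]
  obtain ⟨f, hf1, -, hfc, -⟩ := exists_continuous_one_zero_of_isCompact hK isClosed_empty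
    (disjoint_empty K)
  have hint (n : ℕ) : ∫ x, f x ∂(ρ n) = 1 := by
    have hae : ∀ᵐ x ∂(ρ n), f x = 1 := by
      refine Measure.ae_smul_measure ?_ _
      filter_upwards [ae_restrict_mem hK.measurableSet] with x hx using hf1 hx
    have : IsProbabilityMeasure (ρ n) := ⟨hρuniv n⟩
    rw [integral_congr_ae hae]
    simp
  have hlim := hvc f f.continuous hfc
  simp only [hint, hν0, integral_zero_measure] at hlim
  exact one_ne_zero (tendsto_nhds_unique tendsto_const_nhds hlim)

/-- A strong Cauchy sequence of bounded energy has a strong limit, which is also a vague limit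
along a subnet. -/
theorem exists_strong_limit (hker : IsKernel κ) (hE : EnergyPrinciple κ) (hC : Consistent κ)
    {m : ℕ → Measure X} (hm : ∀ n, m n ∈ Eplus κ) {M : ℝ≥0}
    (hM : ∀ n, energy κ (m n) (m n) ≤ M)
    (hcau : ∀ ε : ℝ, 0 < ε → ∃ N, ∀ i ≥ N, ∀ j ≥ N, strDist κ (m i) (m j) ^ 2 < ε) :
    ∃ ν ∈ Eplus κ, Tendsto (fun n => strDist κ (m n) ν) atTop (𝓝 0) ∧
      ∀ (g : X → ℝ≥0∞) (C : ℝ≥0∞), LowerSemicontinuous g →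
        (∀ᶠ n in atTop, ∫⁻ x, g x ∂(m n) ≤ C) → ∫⁻ x, g x ∂ν ≤ C := by
  have hloc (n : ℕ) := isLocallyFiniteMeasure_of_mem_Eplus (hm n)
  obtain ⟨ν, hν, hvc⟩ := exists_vagueConv (hyperfilter ℕ) hloc fun L hL => by
    obtain ⟨C, hC⟩ := exists_sq_measure_le hker hE hL
    refine ⟨1 + C * M, fun n => ?_⟩
    rcases le_total (m n L) 1 with h1 | h1
    · exact h1.trans (by push_cast; exact le_self_add)
    · calc m n L ≤ m n L ^ 2 := le_self_pow₀ h1 two_ne_zero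
        _ ≤ C * M := (hC _ (hm n)).trans (mul_le_mul_right (hM n) _)
        _ ≤ _ := by push_cast; exact le_add_self
  have hνE : ν ∈ Eplus κ := by
    refine mem_Eplus_iff.2 ⟨hν, (hvc.energy_le hker hloc hν (C := M) ?_).trans_lt
      ENNReal.coe_lt_top⟩
    refine Eventually.of_forall fun j => Eventually.of_forall fun i => ?_
    have h2 := (hE _ (hm i) _ (hm j)).1.trans (add_le_add (hM i) (hM j))
    rw [← two_mul] at h2
    exact (ENNReal.mul_le_mul_iff_right two_ne_zero ENNReal.ofNat_ne_top).1 h2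
  refine ⟨ν, hνE, hC ℕ atTop m inferInstance hm (fun ε hε => ?_) ν
    ⟨hyperfilter ℕ, Nat.hyperfilter_le_atTop, inferInstance, hvc⟩, fun g C hg hgC =>
      hvc.lintegral_le hloc hν hg (hgC.filter_mono Nat.hyperfilter_le_atTop)⟩
  obtain ⟨N, hN⟩ := hcau (ε ^ 2) (by positivity)
  exact ⟨Ici N, Ici_mem_atTop N, fun i hi j hj =>
    lt_of_pow_lt_pow_left₀ 2 hε.le (hN i hi j hj)⟩

end Completeness

section Bal

variable [SecondCountableTopology X] {κ : X → X → ℝ≥0∞}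


/-- If `κμ` integrates to at most `κσ` over every restriction of `τ`, then `κμ ≤ κσ` a.e. -/
theorem ae_pot_le_of_energy_restrict_le (hker : IsKernel κ) (hE : EnergyPrinciple κ)
    {μ σ τ : Measure X} (hσ : σ ∈ Eplus κ) (hτ : τ ∈ Eplus κ)
    (h : ∀ A, MeasurableSet A → energy κ (τ.restrict A) μ ≤ energy κ (τ.restrict A) σ) :
    ∀ᵐ x ∂τ, pot κ μ x ≤ pot κ σ x := by
  have hA : MeasurableSet {x | pot κ σ x < pot κ μ x} :=
    measurableSet_lt (hker.measurable_pot σ) (hker.measurable_pot μ)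
  rw [ae_iff]
  simp only [not_le]
  by_contra h0
  refine (h _ hA).not_gt (setLIntegral_strict_mono hA h0 (hker.measurable_pot μ) ?_
    (ae_of_all _ fun x hx => hx))
  exact (energy_lt_top hE (Eplus_restrict hτ _) hσ).ne

/-- `σ` is the balayage of `μ` to the compact set `K`. -/
structure IsCompactBal (κ : X → X → ℝ≥0∞) (μ : Measure X) (K : Set X) (σ : Measure X) :
    Prop where
  mem : σ ∈ Eplus κ
  supp : σ Kᶜ = 0
  pot_le : ∀ x, pot κ σ x ≤ pot κ μ x
  le_pot : ∀ τ ∈ Eplus κ, τ Kᶜ = 0 → ∀ᵐ x ∂τ, pot κ μ x ≤ pot κ σ x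

theorem exists_isCompactBal (hker : IsKernel κ) (hE : EnergyPrinciple κ) (hC : Consistent κ)
    (hD : Domination κ) {μ : Measure X} (hμ : μ ∈ Eplus κ) {K : Set X} (hK : IsClosed K) :
    ∃ σ, IsCompactBal κ μ K σ := by
  let S : Set (Measure X) := {τ | τ ∈ Eplus κ ∧ τ Kᶜ = 0}
  let J : Measure X → ℝ := fun τ => inn κ τ τ - 2 * inn κ τ μ
  have hadd {τ τ' : Measure X} (h : τ ∈ S) (h' : τ' ∈ S) : τ + τ' ∈ S :=
    ⟨Eplus_add hker hE h.1 h'.1, by simp [h.2, h'.2]⟩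
  have hsmul {τ : Measure X} (c : ℝ≥0) (h : τ ∈ S) : c • τ ∈ S :=
    ⟨Eplus_smul hker h.1 c, by simp [h.2]⟩
  have hbdd : BddBelow (J '' S) := by
    refine ⟨-inn κ μ μ, ?_⟩
    rintro _ ⟨τ, hτ, rfl⟩
    have := two_mul_inn_le hE hτ.1 hμ
    simp only [J]
    linarith
  have hne : (J '' S).Nonempty := ⟨_, 0, ⟨zero_mem_Eplus, by simp⟩, rfl⟩
  set m0 := sInf (J '' S) with hm0
  have hle {τ : Measure X} (h : τ ∈ S) : m0 ≤ J τ := csInf_le hbdd ⟨τ, h, rfl⟩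
  have hex (n : ℕ) : ∃ τ ∈ S, J τ < m0 + 1 / (n + 1) := by
    obtain ⟨_, ⟨τ, hτ, rfl⟩, h⟩ :=
      exists_lt_of_csInf_lt hne (show sInf (J '' S) < m0 + 1 / ((n : ℝ) + 1) by
        rw [← hm0]; linarith [Nat.one_div_pos_of_nat (α := ℝ) (n := n)])
    exact ⟨τ, hτ, h⟩
  choose τ hτS hτJ using hex
  have hpar {τ τ' : Measure X} (h : τ ∈ S) (h' : τ' ∈ S) :
      strDist κ τ τ' ^ 2 ≤ 2 * J τ + 2 * J τ' - 4 * m0 := by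
    have := hle (hsmul (1 / 2) (hadd h h'))
    simp only [J, inn_smul_left, inn_smul_right hker, inn_add_left hE h.1 h'.1 hμ,
      inn_add_left hE h.1 h'.1 (hadd h h').1, inn_add_right hker hE h.1 h'.1 h.1,
      inn_add_right hker hE h.1 h'.1 h'.1, inn_comm hker h'.1 h.1] at this
    push_cast at this
    rw [strDist_sq hE h.1 h'.1]
    simp only [J]
    linarith
  have hbound (n : ℕ) : energy κ (τ n) (τ n) ≤
      (Real.toNNReal (2 * (m0 + 1) + 4 * inn κ μ μ) : ℝ≥0) := by
    rw [← ofReal_inn hE (hτS n).1 (hτS n).1]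
    refine ENNReal.ofReal_le_ofReal ?_
    have h1 := two_mul_inn_le hE (hτS n).1 (Eplus_smul hker hμ 2)
    simp only [inn_smul_left, inn_smul_right hker] at h1
    push_cast at h1
    have h2 := hτJ n
    have h3 : 1 / ((n : ℝ) + 1) ≤ 1 := by
      rw [div_le_one (by positivity)]; linarith [n.cast_nonneg (α := ℝ)]
    simp only [J] at h2
    linarith
  obtain ⟨σ, hσ, hσt, hσg⟩ := exists_strong_limit hker hE hC (fun n => (hτS n).1) hbound (by
    intro ε hε
    obtain ⟨N, hN⟩ := exists_nat_one_div_lt (show 0 < ε / 4 by linarith)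
    refine ⟨N, fun i hi j hj => ?_⟩
    have h1 := hpar (hτS i) (hτS j)
    have h2 := hτJ i
    have h3 := hτJ j
    have h4 := Nat.one_div_le_one_div (α := ℝ) hi
    have h5 := Nat.one_div_le_one_div (α := ℝ) hj
    linarith)
  have hsupp : σ Kᶜ = 0 := by
    have := hσg (Kᶜ.indicator 1) 0
      (hK.isOpen_compl.lowerSemicontinuous_indicator zero_le_one)
      (Eventually.of_forall fun n => by
        simp [lintegral_indicator_one hK.measurableSet.compl, (hτS n).2])
    simpa [lintegral_indicator_one hK.measurableSet.compl] using this
  have hσS : σ ∈ S := ⟨hσ, hsupp⟩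
  have hJσ : J σ ≤ m0 := by
    have h1 : Tendsto (fun n => J (τ n)) atTop (𝓝 (J σ)) :=
      (tendsto_inn_self hker hE (fun n => (hτS n).1) hσ hσt).sub
        ((tendsto_inn hker hE (fun n => (hτS n).1) hσ hμ hσt).const_mul 2)
    have h2 : Tendsto (fun n : ℕ => m0 + 1 / ((n : ℝ) + 1)) atTop (𝓝 (m0 + 0)) :=
      tendsto_one_div_add_atTop_nhds_zero_nat.const_add m0
    rw [add_zero] at h2
    exact le_of_tendsto_of_tendsto' h1 h2 fun n => (hτJ n).le
  have hvar {τ : Measure X} (h : τ ∈ S) : inn κ τ μ ≤ inn κ τ σ := by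
    have key (t : ℝ≥0) (ht : 0 < (t : ℝ)) : inn κ τ μ ≤ inn κ τ σ + t * (inn κ τ τ / 2) := by
      have h1 := hJσ.trans (hle (hadd hσS (hsmul t h)))
      have ht' := hsmul t h
      simp only [J, inn_smul_left, inn_smul_right hker, inn_add_left hE hσ ht'.1 hμ,
        inn_add_left hE hσ ht'.1 (hadd hσS ht').1, inn_add_right hker hE hσ ht'.1 hσ,
        inn_add_right hker hE hσ ht'.1 h.1, inn_comm hker hσ h.1] at h1
      have : 0 ≤ t * (inn κ τ σ + t * (inn κ τ τ / 2) - inn κ τ μ) := by linarith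
      have := nonneg_of_mul_nonneg_right this ht
      linarith
    refine le_of_forall_pos_le_add fun ε hε => ?_
    have hp : 0 < ε / (inn κ τ τ / 2 + 1) := by
      have := inn_nonneg (κ := κ) τ τ
      positivity
    have h1 := key (Real.toNNReal (ε / (inn κ τ τ / 2 + 1)))
    rw [Real.coe_toNNReal _ hp.le] at h1
    refine (h1 hp).trans ?_
    gcongr
    have := inn_nonneg (κ := κ) τ τ
    rw [div_mul_eq_mul_div, div_le_iff₀ (by positivity)]
    nlinarith
  have hself : inn κ σ σ ≤ inn κ σ μ := by
    have key (t : ℝ≥0) (ht : (t : ℝ) < 1) : inn κ σ σ * (1 + t) ≤ 2 * inn κ σ μ := by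
      have h1 := hJσ.trans (hle (hsmul t hσS))
      simp only [J, inn_smul_left, inn_smul_right hker] at h1
      have : 0 ≤ (1 - t) * (2 * inn κ σ μ - inn κ σ σ * (1 + t)) := by linarith
      have := nonneg_of_mul_nonneg_right this (by linarith)
      linarith
    by_contra! hlt
    have hpos : 0 < inn κ σ σ := (inn_nonneg _ _).trans_lt hlt
    have h0 := key 0 (by simp)
    have hp1 : inn κ σ μ / inn κ σ σ < 1 := (div_lt_one hpos).2 hlt
    have h1 := key (Real.toNNReal (inn κ σ μ / inn κ σ σ))
    rw [Real.coe_toNNReal _ (div_nonneg (inn_nonneg _ _) hpos.le)] at h1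
    have h2 := h1 hp1
    rw [mul_add, mul_div_cancel₀ _ hpos.ne'] at h2
    linarith
  have hlp : ∀ τ ∈ Eplus κ, τ Kᶜ = 0 → ∀ᵐ x ∂τ, pot κ μ x ≤ pot κ σ x := by
    intro τ hτ hτK
    refine ae_pot_le_of_energy_restrict_le hker hE hσ hτ fun A hA => ?_
    have hr := Eplus_restrict hτ A
    rw [← ofReal_inn hE hr hμ, ← ofReal_inn hE hr hσ]
    exact ENNReal.ofReal_le_ofReal
      (hvar ⟨hr, le_antisymm ((Measure.restrict_le_self _).trans_eq hτK) zero_le⟩)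
  refine ⟨σ, hσ, hsupp, hD σ hσ μ hμ ?_, hlp⟩
  have heq := ae_eq_of_ae_le_of_lintegral_le (hlp σ hσ hsupp) (energy_lt_top hE hσ hμ).ne
    (hker.measurable_pot σ).aemeasurable (by
      change energy κ σ σ ≤ energy κ σ μ
      rw [← ofReal_inn hE hσ hμ, ← ofReal_inn hE hσ hσ]
      exact ENNReal.ofReal_le_ofReal hself)
  filter_upwards [heq] with x hx using hx.ge

namespace IsCompactBal

variable {μ σ τ ν : Measure X} {K L : Set X}

theorem pot_le_of_ae (hD : Domination κ) (h : IsCompactBal κ μ K σ) (hν : ν ∈ Eplus κ)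
    (hae : ∀ᵐ x ∂σ, pot κ μ x ≤ pot κ ν x) (x : X) : pot κ σ x ≤ pot κ ν x :=
  hD σ h.mem ν hν (hae.mono fun y hy => (h.pot_le y).trans hy) x

/-- `κσ` dominates the potential of each measure on `K` whose potential is at most `κμ`. -/
theorem pot_le_of_supp (hD : Domination κ) (h : IsCompactBal κ μ K σ) (hτ : τ ∈ Eplus κ)
    (hτK : τ Kᶜ = 0) (hle : ∀ x, pot κ τ x ≤ pot κ μ x) (x : X) : pot κ τ x ≤ pot κ σ x :=
  hD τ hτ σ h.mem ((h.le_pot τ hτ hτK).mono fun y hy => (hle y).trans hy) x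

theorem energy_eq_of_supp (h : IsCompactBal κ μ K σ) (hτ : τ ∈ Eplus κ) (hτK : τ Kᶜ = 0) :
    energy κ τ μ = energy κ τ σ :=
  lintegral_congr_ae <| (h.le_pot τ hτ hτK).mono fun y hy => le_antisymm hy (h.pot_le y)

theorem energy_self (h : IsCompactBal κ μ K σ) : energy κ σ μ = energy κ σ σ :=
  h.energy_eq_of_supp h.mem h.supp

theorem inn_self (h : IsCompactBal κ μ K σ) : inn κ σ μ = inn κ σ σ := by
  rw [inn, h.energy_self, inn]

theorem strDist_sq_eq (hE : EnergyPrinciple κ)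
    (h : IsCompactBal κ μ K σ) (h' : IsCompactBal κ μ L τ) (hKL : K ⊆ L) :
    strDist κ σ τ ^ 2 = inn κ τ τ - inn κ σ σ := by
  have : inn κ σ τ = inn κ σ σ := by
    rw [← h.inn_self, inn, inn,
      h'.energy_eq_of_supp h.mem (measure_mono_null (compl_subset_compl.2 hKL) h.supp)]

  rw [strDist_sq hE h.mem h'.mem, this]
  ring

end IsCompactBal

end Bal

section Capacity

variable [SecondCountableTopology X] {κ : X → X → ℝ≥0∞} {μ : Measure X}

/-- The supremum of the energies `κ(τ,μ)` over the `τ ∈ E⁺` carried by a compact subset of `A`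
with `κτ ≤ κμ`; for compact `A` it is the squared norm of the balayage of `μ` to `A`. -/
noncomputable def balCap (κ : X → X → ℝ≥0∞) (μ : Measure X) (A : Set X) : ℝ≥0∞ :=
  ⨆ τ ∈ {τ | τ ∈ Eplus κ ∧ (∀ x, pot κ τ x ≤ pot κ μ x) ∧
    ∃ K ⊆ A, IsCompact K ∧ τ Kᶜ = 0}, energy κ τ μ

theorem balCap_mono {A B : Set X} (h : A ⊆ B) : balCap κ μ A ≤ balCap κ μ B :=
  biSup_mono fun _ hτ => ⟨hτ.1, hτ.2.1, hτ.2.2.imp fun _ hK => ⟨hK.1.trans h, hK.2⟩⟩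

theorem energy_comm_of_mem (hker : IsKernel κ) {ν : Measure X} (hμ : μ ∈ Eplus κ)
    (hν : ν ∈ Eplus κ) : energy κ μ ν = energy κ ν μ := by
  have := isLocallyFiniteMeasure_of_mem_Eplus hμ
  have := isLocallyFiniteMeasure_of_mem_Eplus hν
  exact energy_comm hker μ ν

theorem balCap_lt_top (hker : IsKernel κ) (hμ : μ ∈ Eplus κ) (A : Set X) :
    balCap κ μ A < ⊤ := by
  refine lt_of_le_of_lt (iSup₂_le fun τ hτ => ?_) hμ.2
  rw [energy_comm_of_mem hker hτ.1 hμ]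
  exact lintegral_mono hτ.2.1

theorem IsCompactBal.energy_le_balCap {σ : Measure X} {A K : Set X} (h : IsCompactBal κ μ K σ)
    (hK : IsCompact K) (hKA : K ⊆ A) : energy κ σ μ ≤ balCap κ μ A :=
  le_iSup₂_of_le σ ⟨h.mem, h.pot_le, K, hKA, hK, h.supp⟩ le_rfl

theorem IsCompactBal.balCap_eq (hker : IsKernel κ) (hD : Domination κ) (hμ : μ ∈ Eplus κ)
    {σ : Measure X} {K : Set X} (h : IsCompactBal κ μ K σ) (hK : IsCompact K) :
    balCap κ μ K = energy κ σ μ := by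
  refine le_antisymm (iSup₂_le fun τ ⟨hτ, hle, L, hLK, _, hL⟩ => ?_)
    (h.energy_le_balCap hK Subset.rfl)
  rw [energy_comm_of_mem hker hτ hμ, energy_comm_of_mem hker h.mem hμ]
  exact lintegral_mono
    (h.pot_le_of_supp hD hτ (measure_mono_null (compl_subset_compl.2 hLK) hL) hle)

theorem exists_isCompact_lt_balCap {A : Set X} {a : ℝ≥0∞} (h : a < balCap κ μ A) :
    ∃ K ⊆ A, IsCompact K ∧ a < balCap κ μ K := by
  obtain ⟨τ, ⟨hτ, hle, K, hKA, hK, hτK⟩, hlt⟩ := by simpa only [balCap, lt_iSup_iff] using h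
  exact ⟨K, hKA, hK, hlt.trans_le
    (le_iSup₂_of_le τ ⟨hτ, hle, K, Subset.rfl, hK, hτK⟩ le_rfl)⟩

theorem balCap_eq_iSup_isCompact (A : Set X) :
    balCap κ μ A = ⨆ K ∈ {K | K ⊆ A ∧ IsCompact K}, balCap κ μ K := by
  refine le_antisymm (le_of_forall_lt fun a ha => ?_) (iSup₂_le fun K hK => balCap_mono hK.1)
  obtain ⟨K, hKA, hK, haK⟩ := exists_isCompact_lt_balCap ha
  exact haK.trans_le (le_iSup₂_of_le K ⟨hKA, hK⟩ le_rfl)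

theorem balCap_strongly_subadditive_of_isCompact (hker : IsKernel κ) (hE : EnergyPrinciple κ)
    (hC : Consistent κ) (hD : Domination κ) (hμ : μ ∈ Eplus κ) {K L : Set X}
    (hK : IsCompact K) (hL : IsCompact L) :
    balCap κ μ (K ∪ L) + balCap κ μ (K ∩ L) ≤ balCap κ μ K + balCap κ μ L := by
  obtain ⟨σK, hσK⟩ := exists_isCompactBal hker hE hC hD hμ hK.isClosed
  obtain ⟨σL, hσL⟩ := exists_isCompactBal hker hE hC hD hμ hL.isClosed
  obtain ⟨σu, hσu⟩ := exists_isCompactBal hker hE hC hD hμ (hK.union hL).isClosed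
  obtain ⟨σi, hσi⟩ := exists_isCompactBal hker hE hC hD hμ (hK.inter hL).isClosed
  have hiK := hσK.pot_le_of_supp hD hσi.mem
    (measure_mono_null (compl_subset_compl.2 inter_subset_left) hσi.supp) hσi.pot_le
  have hiL := hσL.pot_le_of_supp hD hσi.mem
    (measure_mono_null (compl_subset_compl.2 inter_subset_right) hσi.supp) hσi.pot_le
  have hae {τ : Measure X} (hτ : τ ∈ Eplus κ) (hs : τ (K ∪ L)ᶜ = 0) :
      ∀ᵐ x ∂τ, pot κ (σu + σi) x ≤ pot κ (σK + σL) x := by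
    have hr : τ.restrict (K ∪ L) = τ := Measure.restrict_eq_self_of_ae_mem hs
    rw [← hr, ae_restrict_union_iff]
    constructor
    · have := hσK.le_pot _ (Eplus_restrict hτ K) (by
        rw [Measure.restrict_apply hK.measurableSet.compl]; simp)
      filter_upwards [this] with x hx
      rw [pot_add, pot_add]
      exact add_le_add ((hσu.pot_le x).trans hx) (hiL x)
    · have := hσL.le_pot _ (Eplus_restrict hτ L) (by
        rw [Measure.restrict_apply hL.measurableSet.compl]; simp)
      filter_upwards [this] with x hx
      rw [pot_add, pot_add, add_comm (pot κ σK x)]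
      exact add_le_add ((hσu.pot_le x).trans hx) (hiK x)
  have hle := hD _ (Eplus_add hker hE hσu.mem hσi.mem) _ (Eplus_add hker hE hσK.mem hσL.mem)
    (hae (Eplus_add hker hE hσu.mem hσi.mem) (by
      simp [-compl_union, hσu.supp, measure_mono_null (compl_subset_compl.2
        (inter_subset_left.trans subset_union_left : K ∩ L ⊆ K ∪ L)) hσi.supp]))
  rw [hσu.balCap_eq hker hD hμ (hK.union hL), hσi.balCap_eq hker hD hμ (hK.inter hL),
    hσK.balCap_eq hker hD hμ hK, hσL.balCap_eq hker hD hμ hL,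
    ← energy_add_left, ← energy_add_left,
    energy_comm_of_mem hker (Eplus_add hker hE hσu.mem hσi.mem) hμ,
    energy_comm_of_mem hker (Eplus_add hker hE hσK.mem hσL.mem) hμ]
  exact lintegral_mono hle

theorem balCap_strongly_subadditive_of_isOpen (hker : IsKernel κ) (hE : EnergyPrinciple κ)
    (hC : Consistent κ) (hD : Domination κ) (hμ : μ ∈ Eplus κ) {U V : Set X}
    (hU : IsOpen U) (hV : IsOpen V) :
    balCap κ μ (U ∪ V) + balCap κ μ (U ∩ V) ≤ balCap κ μ U + balCap κ μ V := by
  rw [balCap_eq_iSup_isCompact (U ∪ V), balCap_eq_iSup_isCompact (U ∩ V)]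
  have hne (A : Set X) : {K | K ⊆ A ∧ IsCompact K}.Nonempty :=
    ⟨∅, empty_subset _, isCompact_empty⟩
  refine ENNReal.biSup_add_biSup_le (hne _) (hne _) fun M ⟨hMU, hM⟩ N ⟨hNU, hN⟩ => ?_
  obtain ⟨K, L, hK, hL, hKU, hLV, rfl⟩ := hM.binary_compact_cover hU hV hMU
  have h := balCap_strongly_subadditive_of_isCompact hker hE hC hD hμ (hK.union hN) (hL.union hN)
  calc _ ≤ balCap κ μ ((K ∪ N) ∪ (L ∪ N)) + balCap κ μ ((K ∪ N) ∩ (L ∪ N)) := by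
        refine add_le_add (balCap_mono ?_) (balCap_mono ?_)
        · exact union_subset_union subset_union_left subset_union_left
        · exact subset_inter subset_union_right subset_union_right
    _ ≤ _ := h
    _ ≤ _ := add_le_add
        (balCap_mono (union_subset hKU (hNU.trans inter_subset_left)))
        (balCap_mono (union_subset hLV (hNU.trans inter_subset_right)))

theorem balCap_iUnion_le {V : ℕ → Set X} (hV : ∀ n, IsOpen (V n)) (hm : Monotone V)
    {c : ℝ≥0∞} (h : ∀ n, balCap κ μ (V n) ≤ c) : balCap κ μ (⋃ n, V n) ≤ c := by
  refine le_of_forall_lt fun a ha => ?_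
  obtain ⟨K, hKV, hK, haK⟩ := exists_isCompact_lt_balCap ha
  obtain ⟨n, hn⟩ := hK.elim_directed_cover V hV hKV hm.directed_le
  exact haK.trans_le ((balCap_mono hn).trans (h n))

/-- The outer capacity associated with `balCap`. -/
noncomputable def balOuterCap (κ : X → X → ℝ≥0∞) (μ : Measure X) (A : Set X) : ℝ≥0∞ :=
  ⨅ U ∈ {U : Set X | IsOpen U ∧ A ⊆ U}, balCap κ μ U

theorem balOuterCap_mono {A B : Set X} (h : A ⊆ B) : balOuterCap κ μ A ≤ balOuterCap κ μ B :=
  biInf_mono fun _ hU => ⟨hU.1, h.trans hU.2⟩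

theorem balOuterCap_le {A U : Set X} (hU : IsOpen U) (h : A ⊆ U) :
    balOuterCap κ μ A ≤ balCap κ μ U := iInf₂_le U ⟨hU, h⟩

theorem balOuterCap_lt_top (hker : IsKernel κ) (hμ : μ ∈ Eplus κ) (A : Set X) :
    balOuterCap κ μ A < ⊤ :=
  (balOuterCap_le isOpen_univ (subset_univ A)).trans_lt (balCap_lt_top hker hμ _)

theorem exists_isOpen_balCap_lt {A : Set X} {a : ℝ≥0∞} (h : balOuterCap κ μ A < a) :
    ∃ U, IsOpen U ∧ A ⊆ U ∧ balCap κ μ U < a := by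
  obtain ⟨U, hlt⟩ := iInf_lt_iff.1 h
  obtain ⟨hU, hlt⟩ := iInf_lt_iff.1 hlt
  exact ⟨U, hU.1, hU.2, hlt⟩

theorem balOuterCap_iUnion_le (hker : IsKernel κ) (hE : EnergyPrinciple κ)
    (hC : Consistent κ) (hD : Domination κ) (hμ : μ ∈ Eplus κ) {A : ℕ → Set X}
    (hA : Monotone A) {c : ℝ≥0∞} (hc : ∀ n, balOuterCap κ μ (A n) ≤ c) :
    balOuterCap κ μ (⋃ n, A n) ≤ c := by
  refine ENNReal.le_of_forall_pos_le_add fun ε hε _ => ?_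
  obtain ⟨δ, hδ, hδs⟩ := ENNReal.exists_pos_sum_of_countable (ENNReal.coe_ne_zero.2 hε.ne') ℕ
  have hex (n : ℕ) : ∃ U, IsOpen U ∧ A n ⊆ U ∧ balCap κ μ U < balOuterCap κ μ (A n) + δ n :=
    exists_isOpen_balCap_lt (ENNReal.lt_add_right (balOuterCap_lt_top hker hμ _).ne
      (ENNReal.coe_ne_zero.2 (hδ n).ne'))
  choose U hU hAU hUlt using hex
  let V : ℕ → Set X := accumulate U
  have hV (n : ℕ) : IsOpen (V n) := isOpen_biUnion fun i _ => hU i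
  have hVle (n : ℕ) :
      balCap κ μ (V n) ≤ balOuterCap κ μ (A n) + ∑ k ∈ Finset.range (n + 1), (δ k : ℝ≥0∞) := by
    induction n with
    | zero => simpa [V] using (hUlt 0).le
    | succ n ih =>
      have h1 := balCap_strongly_subadditive_of_isOpen hker hE hC hD hμ (hV n) (hU (n + 1))
      have h2 : balOuterCap κ μ (A n) ≤ balCap κ μ (V n ∩ U (n + 1)) :=
        balOuterCap_le ((hV n).inter (hU _)) (subset_inter
          ((hAU n).trans (subset_accumulate)) ((hA n.le_succ).trans (hAU _)))
      have h3 : V (n + 1) = V n ∪ U (n + 1) := accumulate_succ U n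
      rw [h3]
      refine (ENNReal.add_le_add_iff_right (balOuterCap_lt_top hker hμ (A n)).ne).1 ?_
      calc _ ≤ _ := add_le_add_right h2 _
        _ ≤ _ := h1
        _ ≤ _ := add_le_add ih (hUlt (n + 1)).le
        _ = _ := by rw [Finset.sum_range_succ _ (n + 1)]; ring
  refine (balOuterCap_le (isOpen_iUnion hV) (iUnion_mono fun n =>
    (hAU n).trans subset_accumulate)).trans (balCap_iUnion_le hV monotone_accumulate fun n => ?_)
  exact (hVle n).trans (add_le_add (hc n) ((ENNReal.sum_le_tsum _).trans hδs.le))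

end Capacity

section Limits

variable [SecondCountableTopology X] {κ : X → X → ℝ≥0∞} {μ : Measure X}

theorem strDist_comm (hker : IsKernel κ) {σ τ : Measure X} (hσ : σ ∈ Eplus κ)
    (hτ : τ ∈ Eplus κ) : strDist κ σ τ = strDist κ τ σ := by
  have := inn_comm hker hσ hτ
  unfold inn at this
  rw [strDist, strDist, this]
  congr 1
  ring

/-- Balayages to a chain of compact sets converge strongly once their norms do. -/
theorem exists_limit_isCompactBal (hker : IsKernel κ) (hE : EnergyPrinciple κ)
    (hC : Consistent κ) (hμ : μ ∈ Eplus κ) {K : ℕ → Set X} {σ : ℕ → Measure X}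
    (hK : ∀ i j, K i ⊆ K j ∨ K j ⊆ K i) (hσ : ∀ n, IsCompactBal κ μ (K n) (σ n))
    (hcau : CauchySeq fun n => inn κ (σ n) (σ n)) :
    ∃ ν ∈ Eplus κ, Tendsto (fun n => strDist κ (σ n) ν) atTop (𝓝 0) ∧
      ∀ (g : X → ℝ≥0∞) (C : ℝ≥0∞), LowerSemicontinuous g →
        (∀ᶠ n in atTop, ∫⁻ x, g x ∂(σ n) ≤ C) → ∫⁻ x, g x ∂ν ≤ C := by
  refine exists_strong_limit hker hE hC (fun n => (hσ n).mem) (M := (energy κ μ μ).toNNReal)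
    (fun n => ?_) fun ε hε => ?_
  · rw [ENNReal.coe_toNNReal hμ.2.ne, ← (hσ n).energy_self,
      energy_comm_of_mem hker (hσ n).mem hμ]
    exact lintegral_mono (hσ n).pot_le
  · obtain ⟨N, hN⟩ := Metric.cauchySeq_iff.1 hcau ε hε
    refine ⟨N, fun i hi j hj => lt_of_le_of_lt ?_ (hN i hi j hj)⟩
    rw [Real.dist_eq]
    rcases hK i j with h | h
    · rw [(hσ i).strDist_sq_eq hE (hσ j) h, abs_sub_comm]
      exact le_abs_self _
    · rw [strDist_comm hker (hσ i).mem (hσ j).mem, (hσ j).strDist_sq_eq hE (hσ i) h]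
      exact le_abs_self _

/-- The potential-theoretic form of the inner balayage of `μ` to `B`, tested against the measures
of finite energy carried by compact subsets of `B`. -/
theorem exists_inner_balayage (hker : IsKernel κ) (hE : EnergyPrinciple κ)
    (hC : Consistent κ) (hD : Domination κ) (hμ : μ ∈ Eplus κ) (B : Set X) :
    ∃ b ∈ Eplus κ,
      (∀ τ ∈ Eplus κ, ∀ L ⊆ B, IsCompact L → τ Lᶜ = 0 →
        ∀ᵐ x ∂τ, pot κ μ x ≤ pot κ b x) ∧
      ∀ ν ∈ Eplus κ, (∀ τ ∈ Eplus κ, ∀ L ⊆ B, IsCompact L → τ Lᶜ = 0 →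
        ∀ᵐ x ∂τ, pot κ μ x ≤ pot κ ν x) → ∀ x, pot κ b x ≤ pot κ ν x := by
  have htop (A : Set X) := (balCap_lt_top hker hμ A).ne
  let c : Set X → ℝ := fun A => (balCap κ μ A).toReal
  have hcm {A A' : Set X} (h : A ⊆ A') : c A ≤ c A' :=
    ENNReal.toReal_mono (htop _) (balCap_mono h)
  have hcK {K : Set X} {σ : Measure X} (hK : IsCompact K) (hσ : IsCompactBal κ μ K σ) :
      inn κ σ σ = c K := by
    simp only [c]
    rw [hσ.balCap_eq hker hD hμ hK, hσ.energy_self, inn]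
  have hex (n : ℕ) : ∃ K ⊆ B, IsCompact K ∧ c B - 1 / (n + 1) < c K := by
    rcases eq_or_ne (balCap κ μ B) 0 with h0 | h0
    · refine ⟨∅, empty_subset _, isCompact_empty, ?_⟩
      have h1 : c B = 0 := by simp [c, h0]
      have h2 : 0 ≤ c ∅ := ENNReal.toReal_nonneg
      linarith [Nat.one_div_pos_of_nat (α := ℝ) (n := n)]
    · have hp : (0 : ℝ) < 1 / (n + 1) := Nat.one_div_pos_of_nat
      have hlt : balCap κ μ B - ENNReal.ofReal (1 / (n + 1)) < balCap κ μ B :=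
        ENNReal.sub_lt_self (htop _) h0 (by simpa using hp)
      obtain ⟨K, hKB, hK, h⟩ := exists_isCompact_lt_balCap hlt
      refine ⟨K, hKB, hK, ?_⟩
      have h3 : balCap κ μ B ≤ balCap κ μ K + ENNReal.ofReal (1 / (n + 1)) :=
        tsub_le_iff_right.1 h.le
      have h4 : balCap κ μ B < balCap κ μ K + ENNReal.ofReal (1 / (n + 1)) := by
        refine lt_of_le_of_ne h3 fun he => ?_
        rw [he, ENNReal.add_sub_cancel_right ENNReal.ofReal_ne_top] at h
        exact lt_irrefl _ h
      have h5 := (ENNReal.toReal_lt_toReal (htop _)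
        (ENNReal.add_ne_top.2 ⟨htop _, ENNReal.ofReal_ne_top⟩)).2 h4
      rw [ENNReal.toReal_add (htop _) ENNReal.ofReal_ne_top, ENNReal.toReal_ofReal hp.le] at h5
      simp only [c]
      linarith
  choose K' hK'B hK'c hK' using hex
  let K : ℕ → Set X := accumulate K'
  have hKm : Monotone K := monotone_accumulate
  have hKB (n : ℕ) : K n ⊆ B := iUnion₂_subset fun i _ => hK'B i
  have hKc (n : ℕ) : IsCompact (K n) := isCompact_accumulate hK'c n
  have hKlt (n : ℕ) : c B - 1 / (n + 1) < c (K n) := (hK' n).trans_le (hcm subset_accumulate)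
  choose σ hσ using fun n => exists_isCompactBal hker hE hC hD hμ (hKc n).isClosed
  have hlim : Tendsto (fun n => c (K n)) atTop (𝓝 (c B)) := by
    refine tendsto_of_tendsto_of_tendsto_of_le_of_le ?_ tendsto_const_nhds
      (fun n => (hKlt n).le) fun n => hcm (hKB n)
    simpa using tendsto_one_div_add_atTop_nhds_zero_nat.const_sub (c B)
  obtain ⟨b, hb, hbt, hbg⟩ := exists_limit_isCompactBal hker hE hC hμ
    (fun i j => (le_total i j).imp (fun h => hKm h) fun h => hKm h) hσ (by
      simp_rw [fun n => hcK (hKc n) (hσ n)]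
      exact hlim.cauchySeq)
  refine ⟨b, hb, fun τ hτ L hLB hL hτL => ?_, fun ν hν h x => ?_⟩
  · refine ae_pot_le_of_energy_restrict_le hker hE hb hτ fun A _ => ?_
    have hr := Eplus_restrict hτ A
    have hrL : (τ.restrict A) Lᶜ = 0 :=
      le_antisymm ((Measure.restrict_le_self _).trans_eq hτL) zero_le
    set ρ := τ.restrict A
    have hsq : (inn κ ρ μ - inn κ b ρ) ^ 2 ≤ 0 * inn κ ρ ρ := by
      have h1 : Tendsto (fun n => (inn κ ρ μ - inn κ (σ n) ρ) ^ 2) atTop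
          (𝓝 ((inn κ ρ μ - inn κ b ρ) ^ 2)) :=
        ((tendsto_inn hker hE (fun n => (hσ n).mem) hb hr hbt).const_sub _).pow 2
      have h2 : Tendsto (fun n : ℕ => 1 / ((n : ℝ) + 1) * inn κ ρ ρ) atTop
          (𝓝 (0 * inn κ ρ ρ)) := tendsto_one_div_add_atTop_nhds_zero_nat.mul_const _
      refine le_of_tendsto_of_tendsto' h1 h2 fun n => ?_
      have hU := (hKc n).union hL
      obtain ⟨σ', hσ'⟩ := exists_isCompactBal hker hE hC hD hμ hU.isClosed
      have h3 : inn κ ρ μ = inn κ σ' ρ := by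
        rw [inn_comm hker hσ'.mem hr, inn, inn, hσ'.energy_eq_of_supp hr
          (measure_mono_null (compl_subset_compl.2 subset_union_right) hrL)]
      have h4 := sq_inn_sub_inn_le hker hE hσ'.mem (hσ n).mem hr
      rw [← h3, strDist_comm hker hσ'.mem (hσ n).mem,
        (hσ n).strDist_sq_eq hE hσ' subset_union_left, hcK hU hσ', hcK (hKc n) (hσ n)] at h4
      refine h4.trans (mul_le_mul_of_nonneg_right ?_ (inn_nonneg _ _))
      have := hcm (union_subset (hKB n) hLB)
      linarith [hKlt n]
    rw [zero_mul] at hsq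
    have heq : inn κ ρ μ = inn κ ρ b := by
      rw [inn_comm hker hr hb]
      exact sub_eq_zero.1 (pow_eq_zero_iff two_ne_zero |>.1 (le_antisymm hsq (sq_nonneg _)))
    rw [← ofReal_inn hE hr hμ, ← ofReal_inn hE hr hb, heq]
  · refine hbg (κ x) _ (hker.lowerSemicontinuous_right x) (Eventually.of_forall fun n => ?_)
    exact (hσ n).pot_le_of_ae hD hν (h _ (hσ n).mem _ (hKB n) (hKc n) (hσ n).supp) x

/-- A compact set whose neighbourhoods have capacities bounded below carries a nonzero measure
of finite energy. -/
theorem exists_measure_of_le_balCap (hker : IsKernel κ) (hE : EnergyPrinciple κ)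
    (hC : Consistent κ) (hD : Domination κ) (hμ : μ ∈ Eplus κ) {K : Set X} (hK : IsCompact K)
    {a : ℝ≥0∞} (ha : 0 < a) (h : ∀ U, IsOpen U → K ⊆ U → a ≤ balCap κ μ U) :
    ∃ τ ∈ Eplus κ, τ Kᶜ = 0 ∧ τ ≠ 0 := by
  have hex (o : Option X) :
      ∃ L, IsCompact L ∧ K ⊆ interior L ∧ ∀ x ∈ o, x ∉ K → x ∉ L := by
    by_cases ho : ∃ x ∈ o, x ∉ K
    · obtain ⟨x, hx, hxK⟩ := ho
      obtain ⟨L, hL, hKL, hLx⟩ := exists_compact_between hK isOpen_compl_singleton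
        (subset_compl_singleton_iff.2 hxK)
      refine ⟨L, hL, hKL, fun y hy _ => ?_⟩
      cases Option.mem_unique hx hy
      exact fun h => hLx h rfl
    · obtain ⟨L, hL, hKL⟩ := exists_compact_superset hK
      exact ⟨L, hL, hKL, fun x hx hxK => (ho ⟨x, hx, hxK⟩).elim⟩
  choose N hNc hKN hN using hex
  obtain ⟨T, hT, hTeq⟩ := TopologicalSpace.isOpen_iUnion_countable (fun o => (N o)ᶜ)
    fun o => (hNc o).isClosed.isOpen_compl
  obtain ⟨e, he⟩ := (hT.insert none).exists_eq_range (insert_nonempty _ _)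
  let L : ℕ → Set X := dissipate (fun n => N (e n))
  have hLanti : Antitone L := antitone_dissipate
  have hLclosed (n : ℕ) : IsClosed (L n) := isClosed_biInter fun i _ => (hNc (e i)).isClosed
  have hLc (n : ℕ) : IsCompact (L n) :=
    (hNc (e n)).of_isClosed_subset (hLclosed n) (biInter_subset_of_mem (mem_Iic.2 le_rfl))
  have hKL (n : ℕ) : K ⊆ interior (L n) := by
    change K ⊆ interior (⋂ i ∈ Iic n, N (e i))
    rw [(finite_Iic n).interior_biInter]
    exact subset_iInter₂ fun i _ => hKN _
  have hLK : Kᶜ ⊆ ⋃ n, (L n)ᶜ := by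
    intro x hx
    have h1 : x ∈ ⋃ o, (N o)ᶜ := mem_iUnion.2 ⟨some x, hN (some x) x rfl hx⟩
    rw [← hTeq] at h1
    obtain ⟨o, hoT, ho⟩ := mem_iUnion₂.1 h1
    obtain ⟨n, rfl⟩ : o ∈ range e := he ▸ mem_insert_of_mem _ hoT
    exact mem_iUnion.2 ⟨n, fun hxL => ho (mem_iInter₂.1 hxL n le_rfl)⟩
  choose σ hσ using fun n => exists_isCompactBal hker hE hC hD hμ (hLclosed n)
  have hσe (n : ℕ) : energy κ (σ n) (σ n) = balCap κ μ (L n) := by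
    rw [(hσ n).balCap_eq hker hD hμ (hLc n), (hσ n).energy_self]
  have htop (A : Set X) := (balCap_lt_top hker hμ A).ne
  have hanti : Antitone fun n => inn κ (σ n) (σ n) := fun i j hij => by
    simp only [inn, hσe]
    exact ENNReal.toReal_mono (htop _) (balCap_mono (hLanti hij))
  obtain ⟨ν, hν, hνt, hνg⟩ := exists_limit_isCompactBal hker hE hC hμ
    (fun i j => (le_total j i).imp (fun h => hLanti h) fun h => hLanti h) hσ
    (tendsto_atTop_ciInf hanti ⟨0, by rintro _ ⟨n, rfl⟩; exact inn_nonneg _ _⟩).cauchySeq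
  refine ⟨ν, hν, measure_mono_null hLK (measure_iUnion_null fun m => ?_), ?_⟩
  · have := hνg ((L m)ᶜ.indicator 1) 0
      ((hLclosed m).isOpen_compl.lowerSemicontinuous_indicator zero_le_one) (by
        filter_upwards [eventually_ge_atTop m] with n hn
        rw [lintegral_indicator_one (hLclosed m).measurableSet.compl,
          measure_mono_null (compl_subset_compl.2 (hLanti hn)) (hσ n).supp])
    simpa [lintegral_indicator_one (hLclosed m).measurableSet.compl] using this
  · rintro rfl
    have h1 := tendsto_inn_self hker hE (fun n => (hσ n).mem) hν hνt
    have h2 : (min a 1).toReal ≤ inn κ (0 : Measure X) 0 := by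
      refine ge_of_tendsto' h1 fun n => ?_
      rw [inn, hσe]
      exact ENNReal.toReal_mono (htop _) ((min_le_left _ _).trans
        ((h _ isOpen_interior (hKL n)).trans (balCap_mono interior_subset)))
    have h3 : 0 < (min a 1).toReal :=
      ENNReal.toReal_pos (by simp [ha.ne']) (by simp)
    simp only [inn, energy_zero_right, ENNReal.toReal_zero] at h2
    linarith

end Limits

section Choquet

theorem analyticSet_of_measurableSet [SecondCountableTopology X] {E : Set X}
    (hE : MeasurableSet E) : AnalyticSet E := by
  have hEeq : E = ⋃ n, compactCovering X n ∩ E := by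
    rw [← iUnion_inter, iUnion_compactCovering, univ_inter]
  rw [hEeq]
  refine AnalyticSet.iUnion fun n => ?_
  have : CompactSpace (compactCovering X n) :=
    isCompact_iff_compactSpace.1 (isCompact_compactCovering X n)
  let := TopologicalSpace.metrizableSpaceMetric (compactCovering X n)
  rw [← Subtype.image_preimage_coe]
  exact (measurable_subtype_coe hE).analyticSet.image_of_continuous continuous_subtype_val

theorem isCompact_setOf_forall_le (n : ℕ → ℕ) : IsCompact {s : ℕ → ℕ | ∀ i, s i ≤ n i} := by
  have h : IsCompact (Iic n) := by
    simpa using isCompact_univ_pi fun i => (finite_Iic (n i)).isCompact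
  exact h

/-- A neighbourhood of a compact box in Baire space contains a box bounded in finitely many
coordinates. -/
theorem exists_subset_of_pi_Iic_subset {n : ℕ → ℕ} {V : Set (ℕ → ℕ)} (hV : IsOpen V)
    (h : {s | ∀ i, s i ≤ n i} ⊆ V) : ∃ k, {s : ℕ → ℕ | ∀ i < k, s i ≤ n i} ⊆ V := by
  by_contra! hcon
  simp only [not_subset] at hcon
  choose s hs hsV using hcon
  have hP := isCompact_setOf_forall_le n
  let t : ℕ → ℕ → ℕ := fun k i => min (s k i) (n i)
  obtain ⟨r, hr, φ, hφ, hlim⟩ := hP.tendsto_subseq (x := t) fun k i => min_le_right _ _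
  have hs' : Tendsto (s ∘ φ) atTop (𝓝 r) := by
    rw [tendsto_pi_nhds] at hlim ⊢
    intro i
    refine (hlim i).congr' ?_
    filter_upwards [eventually_gt_atTop i] with k hk
    exact min_eq_left (hs _ _ (hk.trans_le hφ.le_apply))
  obtain ⟨k, hk⟩ := (hs'.eventually (hV.mem_nhds (h hr))).exists
  exact hsV _ hk

/-- Choquet's capacitability theorem for analytic sets. -/
theorem exists_isCompact_of_analyticSet {Y : Type*} [TopologicalSpace Y] {c : Set Y → ℝ≥0∞}
    (hmono : ∀ A B, A ⊆ B → c A ≤ c B)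
    (hsup : ∀ (A : ℕ → Set Y) (r : ℝ≥0∞), Monotone A → (∀ n, c (A n) ≤ r) → c (⋃ n, A n) ≤ r)
    {E : Set Y} (hE : AnalyticSet E) {a : ℝ≥0∞} (ha : a < c E) :
    ∃ K ⊆ E, IsCompact K ∧ ∀ U, IsOpen U → K ⊆ U → a ≤ c U := by
  rw [AnalyticSet] at hE
  obtain rfl | ⟨f, hf, rfl⟩ := hE
  · exact ⟨∅, Subset.rfl, isCompact_empty, fun U _ hU => ha.le.trans (hmono _ _ hU)⟩
  have hstep (k : ℕ) (T : Set (ℕ → ℕ)) (hT : a < c (f '' T)) :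
      ∃ m, a < c (f '' (T ∩ {s | s k ≤ m})) := by
    by_contra! hcon
    refine hT.not_ge ?_
    have h1 := hsup (fun m => f '' (T ∩ {s | s k ≤ m})) a (fun i j hij => by
      refine image_mono (inter_subset_inter_right _ fun s hs => ?_)
      exact le_trans hs hij) hcon
    refine (hmono _ _ ?_).trans h1
    rintro _ ⟨s, hs, rfl⟩
    exact mem_iUnion.2 ⟨s k, s, ⟨hs, by simp⟩, rfl⟩
  choose! N hN using hstep
  let T : ℕ → Set (ℕ → ℕ) :=
    fun k => k.rec univ fun i S => S ∩ {s | s i ≤ N i S}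
  have hTs (k : ℕ) : T (k + 1) = T k ∩ {s | s k ≤ N k (T k)} := rfl
  have hTc (k : ℕ) : a < c (f '' T k) := by
    induction k with
    | zero => simpa [T] using ha
    | succ k ih => rw [hTs]; exact hN k _ ih
  have hT (k : ℕ) : T k = {s | ∀ i < k, s i ≤ N i (T i)} := by
    induction k with
    | zero => simp [T]
    | succ k ih =>
      rw [hTs]
      ext s
      have hs : s ∈ T k ↔ ∀ i < k, s i ≤ N i (T i) := iff_of_eq (congrArg (s ∈ ·) ih)
      simp only [mem_inter_iff, mem_ofPred_eq, Nat.forall_lt_succ_right, hs]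
  have hP := isCompact_setOf_forall_le fun i => N i (T i)
  refine ⟨_, image_subset_range f _, hP.image hf, fun U hU hKU => ?_⟩
  obtain ⟨k, hk⟩ := exists_subset_of_pi_Iic_subset (hU.preimage hf) (image_subset_iff.1 hKU)
  rw [← hT k] at hk
  exact (hTc k).le.trans (hmono _ _ (image_subset_iff.2 hk))

variable [SecondCountableTopology X] {κ : X → X → ℝ≥0∞} {μ : Measure X}

theorem balOuterCap_eq_zero (hker : IsKernel κ) (hE : EnergyPrinciple κ)
    (hC : Consistent κ) (hD : Domination κ) (hμ : μ ∈ Eplus κ) {E : Set X}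
    (hEm : MeasurableSet E)
    (h : ∀ τ ∈ Eplus κ, ∀ K ⊆ E, IsCompact K → τ Kᶜ = 0 → τ = 0) :
    balOuterCap κ μ E = 0 := by
  by_contra h0
  obtain ⟨a, ha0, ha⟩ := exists_between (pos_iff_ne_zero.2 h0)
  obtain ⟨K, hKE, hK, hU⟩ := exists_isCompact_of_analyticSet (c := balOuterCap κ μ)
    (fun A B hAB => balOuterCap_mono hAB)
    (fun A r hA hr => balOuterCap_iUnion_le hker hE hC hD hμ hA hr)
    (analyticSet_of_measurableSet hEm) ha
  obtain ⟨τ, hτ, hτK, hτ0⟩ := exists_measure_of_le_balCap hker hE hC hD hμ hK ha0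
    fun U hUo hKU => (hU U hUo hKU).trans (balOuterCap_le hUo Subset.rfl)
  exact hτ0 (h τ hτ K hKE hK hτK)

end Choquet

section OuterCapacity

variable [SecondCountableTopology X] {κ : X → X → ℝ≥0∞} {μ : Measure X}

theorem innerCap_mono_of_measurableSet {A D : Set X} (hD : MeasurableSet D) (h : A ⊆ D) :
    innerCap κ A ≤ innerCap κ D :=
  ENNReal.inv_le_inv.2 <| biInf_mono fun _ hτ =>
    ⟨⟨hτ.1.1, hD.nullMeasurableSet, fun K hK => measure_mono_null
      (inter_subset_inter_left _ (compl_subset_compl.2 h)) (hτ.1.2.2 K hK)⟩, hτ.2⟩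

theorem innerCap_le_outerCap (A : Set X) : innerCap κ A ≤ outerCap κ A :=
  le_iInf₂ fun _ hD => innerCap_mono_of_measurableSet hD.1.measurableSet hD.2

theorem ConcOn.measure_compl {τ : Measure X} {A : Set X} (h : ConcOn τ A) : τ Aᶜ = 0 := by
  rw [← inter_univ Aᶜ, ← iUnion_compactCovering, inter_iUnion]
  exact measure_iUnion_null fun n => h.2 _ (isCompact_compactCovering X n)

theorem measure_eq_zero_of_innerCap_eq_zero (hker : IsKernel κ) {S : Set X}
    (hS : MeasurableSet S) (h : innerCap κ S = 0) {τ : Measure X} (hτ : τ ∈ Eplus κ) :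
    τ S = 0 := by
  by_contra h0
  have := isLocallyFiniteMeasure_of_mem_Eplus hτ
  obtain ⟨L, hLS, hL, hL0⟩ := hS.exists_lt_isCompact (pos_iff_ne_zero.2 h0)
  set c : ℝ≥0 := (τ L).toNNReal⁻¹ with hc
  have hρ := Eplus_smul hker (Eplus_restrict hτ L) c
  have hnn : (τ L).toNNReal ≠ 0 := by
    simp [ENNReal.toNNReal_eq_zero_iff, hL0.ne', hL.measure_lt_top.ne]
  have h1 : (c • τ.restrict L) univ = 1 := by
    rw [Measure.smul_apply, Measure.restrict_apply_univ, ENNReal.smul_def, smul_eq_mul, hc,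
      ENNReal.coe_inv hnn, ENNReal.coe_toNNReal hL.measure_lt_top.ne]
    exact ENNReal.inv_mul_cancel hL0.ne' hL.measure_lt_top.ne
  have hconc : ConcOn (c • τ.restrict L) S := by
    refine ⟨hS.nullMeasurableSet, fun K _ => ?_⟩
    have : (τ.restrict L) Sᶜ = 0 := by
      rw [Measure.restrict_apply hS.compl]
      exact measure_mono_null (fun x hx => hx.1 (hLS hx.2)) measure_empty
    simp [measure_mono_null inter_subset_left this]
  rw [innerCap, ENNReal.inv_eq_zero] at h
  have h2 := iInf₂_le (f := fun ν (_ : ν ∈ {μ ∈ EplusOn κ S | μ univ = 1}) => energy κ ν ν) _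
    (show (c • τ.restrict L) ∈ {μ ∈ EplusOn κ S | μ univ = 1} from ⟨⟨hρ, hconc⟩, h1⟩)
  exact (hρ.2.trans_eq h.symm).not_ge h2

theorem sq_energy_le (hker : IsKernel κ) (hE : EnergyPrinciple κ) {σ τ : Measure X}
    (hσ : σ ∈ Eplus κ) (hτ : τ ∈ Eplus κ) :
    energy κ σ τ ^ 2 ≤ energy κ σ σ * energy κ τ τ := by
  rw [← ofReal_inn hE hσ hτ, ← ofReal_inn hE hσ hσ, ← ofReal_inn hE hτ hτ,
    ← ENNReal.ofReal_pow (inn_nonneg _ _), ← ENNReal.ofReal_mul (inn_nonneg _ _)]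
  exact ENNReal.ofReal_le_ofReal (sq_inn_le hker hE hσ hτ)

/-- A capacitary weak-type estimate. -/
theorem sq_mul_measure_le (hker : IsKernel κ) (hE : EnergyPrinciple κ)
    (hC : Consistent κ) (hD : Domination κ) (hμ : μ ∈ Eplus κ) {τ : Measure X}
    (hτ : τ ∈ Eplus κ) {L A : Set X} (hL : IsCompact L) (hLA : L ⊆ A) {r : ℝ≥0∞}
    (hr : ∀ x ∈ L, r ≤ pot κ μ x) :
    (r * τ L) ^ 2 ≤ energy κ τ τ * balCap κ μ A := by
  obtain ⟨σ, hσ⟩ := exists_isCompactBal hker hE hC hD hμ hL.isClosed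
  have hρ := Eplus_restrict hτ L
  have hle : r * τ L ≤ energy κ τ σ := by
    calc r * τ L = ∫⁻ _ in L, r ∂τ := by rw [setLIntegral_const]
      _ ≤ energy κ (τ.restrict L) μ := setLIntegral_mono (hker.measurable_pot μ) hr
      _ = energy κ (τ.restrict L) σ := hσ.energy_eq_of_supp hρ (by
          rw [Measure.restrict_apply hL.measurableSet.compl]; simp)
      _ ≤ energy κ τ σ := lintegral_mono' Measure.restrict_le_self le_rfl
  calc _ ≤ energy κ τ σ ^ 2 := by gcongr
    _ ≤ energy κ τ τ * energy κ σ σ := sq_energy_le hker hE hτ hσ.mem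
    _ ≤ _ := by
      rw [← hσ.energy_self]
      gcongr
      exact hσ.energy_le_balCap hL hLA

theorem outerCap_eq_zero_of_balOuterCap_eq_zero (hker : IsKernel κ) (hE : EnergyPrinciple κ)
    (hC : Consistent κ) (hD : Domination κ) (hμ : μ ∈ Eplus κ) {E : Set X}
    (hpos : ∀ x ∈ E, 0 < pot κ μ x) (h : balOuterCap κ μ E = 0) : outerCap κ E = 0 := by
  suffices hη : ∀ η : ℝ≥0, 0 < η → outerCap κ E ≤ (η : ℝ≥0∞) ^ 2 by
    refine le_antisymm (ENNReal.le_of_forall_pos_le_add fun ε hε _ => ?_) zero_le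
    rw [zero_add]
    have hs := hη (NNReal.sqrt ε) (NNReal.sqrt_pos.2 hε)
    rwa [← ENNReal.coe_pow, NNReal.sq_sqrt] at hs
  intro η hη
  obtain ⟨δ, hδ, hδs⟩ := ENNReal.exists_pos_sum_of_countable (ENNReal.coe_ne_zero.2 hη.ne') ℕ
  let r : ℕ → ℝ≥0∞ := fun k => ((k : ℝ≥0∞) + 1)⁻¹
  have hr0 (k : ℕ) : r k ≠ 0 := by simp [r]
  have hrt (k : ℕ) : r k ≠ ⊤ := by simp [r]
  have hex (k : ℕ) : ∃ U, IsOpen U ∧ E ⊆ U ∧ balCap κ μ U < (r k * δ k) ^ 2 :=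
    exists_isOpen_balCap_lt (h ▸ pos_iff_ne_zero.2 (by simp [hr0, (hδ k).ne']))
  choose U hU hEU hUlt using hex
  let D : ℕ → Set X := fun k => U k ∩ {x | r k < pot κ μ x}
  have hDo (k : ℕ) : IsOpen (D k) :=
    (hU k).inter ((hker.lowerSemicontinuous_pot μ).isOpen_preimage (r k))
  have hED : E ⊆ ⋃ k, D k := fun x hx => by
    obtain ⟨n, hn⟩ := ENNReal.exists_inv_nat_lt (hpos x hx).ne'
    refine mem_iUnion.2 ⟨n, hEU n hx, lt_of_le_of_lt ?_ hn⟩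
    exact ENNReal.inv_le_inv.2 le_self_add
  refine iInf₂_le_of_le (⋃ k, D k) ⟨isOpen_iUnion hDo, hED⟩ ?_
  rw [innerCap, ENNReal.inv_le_iff_inv_le]
  refine le_iInf₂ fun τ ⟨⟨hτ, hconc⟩, hτ1⟩ => ?_
  have := hτ.1.1
  set s := energy κ τ τ ^ (1 / 2 : ℝ) with hs
  have hs2 : s ^ 2 = energy κ τ τ := by
    rw [hs, ← ENNReal.rpow_natCast, ← ENNReal.rpow_mul]
    norm_num
  have hτD (k : ℕ) : τ (D k) ≤ s * δ k := by
    rw [(hDo k).measurableSet.measure_eq_iSup_isCompact]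
    refine iSup₂_le fun L hLD => iSup_le fun hL => ?_
    have h1 := (sq_mul_measure_le hker hE hC hD hμ hτ hL (hLD.trans inter_subset_left)
      (fun x hx => (hLD hx).2.le)).trans (mul_le_mul_right (hUlt k).le _)
    rw [← hs2, ← mul_pow, mul_left_comm] at h1
    exact (ENNReal.mul_le_mul_iff_right (hr0 k) (hrt k)).1
      ((ENNReal.pow_le_pow_left_iff two_ne_zero).1 h1)
  have h1 : 1 ≤ s * η := by
    calc 1 = τ univ := hτ1.symm
      _ ≤ τ (⋃ k, D k) + τ (⋃ k, D k)ᶜ := by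
        rw [← union_compl_self (⋃ k, D k)]; exact measure_union_le _ _
      _ = τ (⋃ k, D k) := by rw [hconc.measure_compl, add_zero]
      _ ≤ ∑' k, τ (D k) := measure_iUnion_le _
      _ ≤ ∑' k, s * δ k := ENNReal.tsum_le_tsum hτD
      _ = s * ∑' k, (δ k : ℝ≥0∞) := ENNReal.tsum_mul_left
      _ ≤ s * η := by gcongr
  rw [ENNReal.inv_le_iff_le_mul (by simp [hη.ne']) (by simp), mul_comm, ← hs2, ← mul_pow]
  exact one_le_pow₀ h1

end OuterCapacity

/-- For second-countable `X`, the outer balayage to a Borel set exists and coincides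
with the inner balayage. -/
theorem statement12 [SecondCountableTopology X] (κ : X → X → ℝ≥0∞) (hker : IsKernel κ)
    (hE : EnergyPrinciple κ) (hC : Consistent κ) (hD : Domination κ) :
    ∀ μ ∈ Eplus κ, ∀ B : Set X, MeasurableSet B →
      ∃ b : Measure X, IsOuterBal κ B μ b ∧ IsInnerBal κ B μ b := by
  intro μ hμ B hB
  obtain ⟨b, hb, hbge, hbmin⟩ := exists_inner_balayage hker hE hC hD hμ B
  have hmeas (ν : Measure X) : MeasurableSet {x | x ∈ B ∧ ¬ pot κ μ x ≤ pot κ ν x} :=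
    hB.inter (measurableSet_le (hker.measurable_pot μ) (hker.measurable_pot ν)).compl
  have hQE : b ∈ OuterLam κ B μ := by
    refine ⟨hb, outerCap_eq_zero_of_balOuterCap_eq_zero hker hE hC hD hμ
      (fun x hx => zero_le.trans_lt (not_le.1 hx.2))
      (balOuterCap_eq_zero hker hE hC hD hμ (hmeas b) fun τ hτ K hK hKc hτK => ?_)⟩
    rw [← Measure.measure_univ_eq_zero, ← union_compl_self K]
    refine measure_union_null (measure_mono_null (fun x hx => (hK hx).2) ?_) hτK
    exact hbge τ hτ K (fun x hx => (hK hx).1) hKc hτK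
  have hsub : OuterLam κ B μ ⊆ InnerLam κ B μ := fun ν hν =>
    ⟨hν.1, le_antisymm ((innerCap_le_outerCap _).trans_eq hν.2) zero_le⟩
  have hmin : ∀ ν ∈ InnerLam κ B μ, ∀ x, pot κ b x ≤ pot κ ν x := fun ν hν => by
    refine hbmin ν hν.1 fun τ hτ L hLB _ hτL => ?_
    refine measure_mono_null (fun x hx => ?_) (measure_union_null
      (measure_eq_zero_of_innerCap_eq_zero hker (hmeas ν) hν.2 hτ) hτL)
    exact (em (x ∈ L)).imp (fun hxL => ⟨hLB hxL, hx⟩) id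
  exact ⟨b, ⟨hQE, fun ν hν => hmin ν (hsub hν)⟩, hsub hQE, hmin⟩

end Balayage
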